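/- (Bilinear estimate for Vlasov–Yukawa.) Let n ≥ 2 and N ≥ 2n. There exists a constant C, depending only on n and N, such that the following holds. Let t ≥ 0, ε > 0, let f : ℝⁿ_x × ℝⁿ_v → ℝ be smooth and compactly supported with Σ_{|α| ≤ N, Z^α ∈ γ^{|α|}} ‖Z^α f‖_{L¹(ℝⁿ_x × ℝⁿ_v)} ≤ 2ε, and let φ(x) = ∫ G₁(x−y) ρ(f)(y) dy. Then for all multi-indices γ, β with |γ| ≤ N, |β| ≤ N, |γ| + |β| ≤ N + 1, and all compositions Z^γ ∈ Γ^{|γ|}, Z^β ∈ γ^{|β|}: ‖∇ₓ(Z^γ φ) · Z^β f‖_{L¹(ℝⁿ_x × ℝⁿ_v)} ≤ C ε (1+t)^{−n} Σ_{|β'| ≤ N, Z^{β'} ∈ γ^{|β'|}} ‖Z^{β'} f‖_{L¹(ℝⁿ_x × ℝⁿ_v)}. -/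

import Mathlib

noncomputable section

open MeasureTheory Real

/-- `E n` is the Euclidean space `ℝⁿ`. -/
abbrev E (n : ℕ) : Type := EuclideanSpace ℝ (Fin n)

/-- Index set for the commuting vector fields: spatial translations `∂_{xⁱ}`,
uniform motions `t∂_{xⁱ} + ∂_{vⁱ}` (macroscopically `t∂_{xⁱ}`),
rotations `Ωˣᵢⱼ + Ωᵛᵢⱼ` for `i < j` (macroscopically `Ωˣᵢⱼ`),
and the scaling `Sˣ + Sᵛ` (macroscopically `Sˣ`). -/
abbrev VFIdx (n : ℕ) : Type := Fin n ⊕ Fin n ⊕ {p : Fin n × Fin n // p.1 < p.2} ⊕ Unit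

variable {n : ℕ}

/-- Partial derivative of `g : ℝⁿ → ℝ` at `x` in the `i`-th coordinate direction. -/
def pd (i : Fin n) (g : E n → ℝ) (x : E n) : ℝ :=
  fderiv ℝ g x (EuclideanSpace.single i 1)

/-- Iterated coordinate partial derivatives `∂ₓ^α`. -/
def pdList (ds : List (Fin n)) (g : E n → ℝ) : E n → ℝ :=
  ds.foldr (fun i h => pd i h) g

/-- The action of a microscopic vector field of the family `γ`
on a function `f(t,x,v)`. -/
def microApply (Z : VFIdx n) (f : ℝ → E n → E n → ℝ) : ℝ → E n → E n → ℝ :=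
  fun t x v =>
    match Z with
    | Sum.inl i => pd i (fun y => f t y v) x
    | Sum.inr (Sum.inl i) => t * pd i (fun y => f t y v) x + pd i (fun w => f t x w) v
    | Sum.inr (Sum.inr (Sum.inl p)) =>
        x p.1.1 * pd p.1.2 (fun y => f t y v) x - x p.1.2 * pd p.1.1 (fun y => f t y v) x
          + v p.1.1 * pd p.1.2 (fun w => f t x w) v - v p.1.2 * pd p.1.1 (fun w => f t x w) v
    | Sum.inr (Sum.inr (Sum.inr _)) =>
        (∑ i, x i * pd i (fun y => f t y v) x) + ∑ i, v i * pd i (fun w => f t x w) v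

/-- The action of a macroscopic vector field of the family `Γ`
on a function `φ(t,x)`. -/
def macroApply (Z : VFIdx n) (φ : ℝ → E n → ℝ) : ℝ → E n → ℝ :=
  fun t x =>
    match Z with
    | Sum.inl i => pd i (φ t) x
    | Sum.inr (Sum.inl i) => t * pd i (φ t) x
    | Sum.inr (Sum.inr (Sum.inl p)) =>
        x p.1.1 * pd p.1.2 (φ t) x - x p.1.2 * pd p.1.1 (φ t) x
    | Sum.inr (Sum.inr (Sum.inr _)) => ∑ i, x i * pd i (φ t) x

/-- Composition `Z^α = Z^{α₁} ⋯ Z^{α_k}` of microscopic vector fields. -/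
def microList (L : List (VFIdx n)) (f : ℝ → E n → E n → ℝ) : ℝ → E n → E n → ℝ :=
  L.foldr microApply f

/-- Composition `Z^α = Z^{α₁} ⋯ Z^{α_k}` of macroscopic vector fields. -/
def macroList (L : List (VFIdx n)) (φ : ℝ → E n → ℝ) : ℝ → E n → ℝ :=
  L.foldr macroApply φ

/-- Velocity average `ρ(f)(t,x) = ∫ f(t,x,v) dv`. -/
def rho (f : ℝ → E n → E n → ℝ) (t : ℝ) (x : E n) : ℝ := ∫ v : E n, f t x v

/-- The spatial Laplacian. -/
def lap (g : E n → ℝ) (x : E n) : ℝ := ∑ i, pd i (fun y => pd i g y) x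

/-- The free transport operator `T(f) = ∂_t f + v·∇ₓ f`. -/
def Tfree (f : ℝ → E n → E n → ℝ) : ℝ → E n → E n → ℝ :=
  fun t x v => deriv (fun s => f s x v) t + ∑ i, v i * pd i (fun y => f t y v) x

/-- The perturbed transport operator `T_φ(f) = ∂_t f + v·∇ₓ f + μ ∇ₓφ·∇ᵥ f`. -/
def Tphi (μ : ℝ) (φ : ℝ → E n → ℝ) (f : ℝ → E n → E n → ℝ) : ℝ → E n → E n → ℝ :=
  fun t x v => Tfree f t x v + μ * ∑ i, pd i (φ t) x * pd i (fun w => f t x w) v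

/-- The energy `𝓔_N[f](t) = Σ_{|α| ≤ N} ‖Z^α f‖_{L¹(ℝⁿ_x × ℝⁿ_v)}`. -/
def energy (n N : ℕ) (f : ℝ → E n → E n → ℝ) (t : ℝ) : ℝ :=
  ∑ m ∈ Finset.range (N + 1), ∑ α : Fin m → VFIdx n,
    ∫ x : E n, ∫ v : E n, |microList (List.ofFn α) f t x v|

/-- Smoothness of a function of `(t,x,v)`. -/
def SmoothTXV (n : ℕ) (f : ℝ → E n → E n → ℝ) : Prop :=
  ContDiff ℝ (⊤ : ℕ∞) (fun p : ℝ × E n × E n => f p.1 p.2.1 p.2.2)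

/-- Smoothness of a function of `(t,x)`. -/
def SmoothTX (n : ℕ) (φ : ℝ → E n → ℝ) : Prop :=
  ContDiff ℝ (⊤ : ℕ∞) (fun p : ℝ × E n => φ p.1 p.2)

/-- The modified Bessel function of the second kind `K_ν(r)`. -/
def Kfun (ν r : ℝ) : ℝ :=
  ∫ l in Set.Ioi (0 : ℝ), Real.exp (-(r * Real.cosh l)) * Real.cosh (ν * l)

/-- The Yukawa Green's function `G₁(x) = c |x|^{1-n/2} K_{n/2-1}(|x|)`. -/
def Gyukawa (n : ℕ) (c : ℝ) (x : E n) : ℝ :=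
  c * ‖x‖ ^ ((1 : ℝ) - (n : ℝ) / 2) * Kfun ((n : ℝ) / 2 - 1) ‖x‖

/-- Convolution of two scalar functions on `ℝⁿ`. -/
def conv (g h : E n → ℝ) (x : E n) : ℝ := ∫ y : E n, g (x - y) * h y

/-- `k`-fold convolution with `g` (the `0`-fold one being the identity). -/
def convIter (g : E n → ℝ) : ℕ → (E n → ℝ) → E n → ℝ
  | 0, h => h
  | m + 1, h => conv g (convIter g m h)

theorem kf_exp_bound {p y : ℝ} (hp : 0 < p) (hy : 0 < y) : exp (-y) ≤ p ^ p * y ^ (-p) := by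
  have h1 : y / p ≤ exp (y / p) := by
    have := Real.add_one_le_exp (y / p); linarith
  have h2 : (y / p) ^ p ≤ exp y := by
    calc (y / p) ^ p ≤ (exp (y / p)) ^ p := Real.rpow_le_rpow (by positivity) h1 hp.le
      _ = exp y := by rw [← Real.exp_mul]; congr 1; field_simp
  rw [Real.div_rpow hy.le hp.le, div_le_iff₀ (by positivity)] at h2
  rw [Real.exp_neg, Real.rpow_neg hy.le, ← div_eq_mul_inv, le_div_iff₀ (by positivity),
    inv_mul_le_iff₀ (exp_pos _)]
  exact h2

theorem kf_cosh_le (μ : ℝ) {l : ℝ} (hl : 0 ≤ l) : cosh (μ * l) ≤ exp (|μ| * l) := by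
  rw [← Real.cosh_abs, abs_mul, abs_of_nonneg hl, Real.cosh_eq]
  have : exp (-(|μ| * l)) ≤ exp (|μ| * l) := by
    apply Real.exp_le_exp.2
    have : 0 ≤ |μ| * l := by positivity
    linarith
  linarith

/-- constant in the Bessel bound -/
def kfA (μ : ℝ) : ℝ := (|μ| + 1 / 2) ^ (|μ| + 1 / 2) * (4 : ℝ) ^ (|μ| + 1 / 2)

theorem kfA_nonneg (μ : ℝ) : 0 ≤ kfA μ := by unfold kfA; positivity

theorem kf_integrand_bound (μ : ℝ) {r l : ℝ} (hr : 0 < r) (hl : 0 ≤ l) :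
    exp (-(r * cosh l)) * cosh (μ * l) ≤
      kfA μ * r ^ (-(|μ| + 1 / 2)) * exp (-(r / 2)) * exp (-(1 / 2) * l) := by
  set p := |μ| + 1 / 2 with hp
  have hp0 : 0 < p := by positivity
  have hc : exp l / 2 ≤ cosh l := by
    rw [Real.cosh_eq]; have := exp_pos (-l); linarith
  have h1 : exp (-(r * cosh l)) ≤ exp (-(r / 2)) * exp (-(r / 4 * exp l)) := by
    rw [← Real.exp_add]
    apply Real.exp_le_exp.2
    have := Real.one_le_cosh l
    nlinarith
  have h2 : exp (-(r / 4 * exp l)) ≤ p ^ p * (r / 4 * exp l) ^ (-p) :=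
    kf_exp_bound hp0 (by positivity)
  have h3 : (r / 4 * exp l) ^ (-p) = r ^ (-p) * 4 ^ p * exp (-(p * l)) := by
    rw [Real.mul_rpow (by positivity) (by positivity), Real.div_rpow hr.le (by norm_num),
      ← Real.exp_mul, Real.rpow_neg (by norm_num : (0:ℝ) ≤ 4), div_inv_eq_mul]
    congr 2; ring
  have h4 := kf_cosh_le μ hl
  calc exp (-(r * cosh l)) * cosh (μ * l)
      ≤ (exp (-(r / 2)) * (p ^ p * (r ^ (-p) * 4 ^ p * exp (-(p * l))))) * exp (|μ| * l) := by
        rw [← h3]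
        gcongr
        exact h1.trans (by gcongr)
    _ = kfA μ * r ^ (-p) * exp (-(r / 2)) * (exp (-(p * l)) * exp (|μ| * l)) := by
        unfold kfA; rw [← hp]; ring
    _ = _ := by
        rw [← Real.exp_add]; congr 2; rw [hp]; ring

theorem kf_integrableOn (μ : ℝ) {r : ℝ} (hr : 0 < r) :
    IntegrableOn (fun l => exp (-(r * cosh l)) * cosh (μ * l)) (Set.Ioi 0) := by
  have h := (integrableOn_exp_mul_Ioi (a := -(1/2 : ℝ)) (by norm_num) 0).const_mul
    (kfA μ * r ^ (-(|μ| + 1 / 2)) * exp (-(r / 2)))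
  refine Integrable.mono' h (Continuous.aestronglyMeasurable (by fun_prop)) ?_
  refine (ae_restrict_mem measurableSet_Ioi).mono fun l hl => ?_
  rw [Real.norm_of_nonneg (mul_nonneg (exp_pos _).le (Real.cosh_pos _).le)]
  exact kf_integrand_bound μ hr (le_of_lt hl)

theorem Kfun_nonneg (μ r : ℝ) : 0 ≤ Kfun μ r :=
  integral_nonneg fun _ => mul_nonneg (exp_pos _).le (Real.cosh_pos _).le

theorem Kfun_bound (μ : ℝ) {r : ℝ} (hr : 0 < r) :
    Kfun μ r ≤ 2 * kfA μ * r ^ (-(|μ| + 1 / 2)) * exp (-(r / 2)) := by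
  have h := (integrableOn_exp_mul_Ioi (a := -(1/2 : ℝ)) (by norm_num) 0).const_mul
    (kfA μ * r ^ (-(|μ| + 1 / 2)) * exp (-(r / 2)))
  have := setIntegral_mono_on (kf_integrableOn μ hr) h measurableSet_Ioi
    (fun l hl => kf_integrand_bound μ hr (le_of_lt hl))
  refine this.trans (le_of_eq ?_)
  rw [integral_const_mul, integral_exp_mul_Ioi (by norm_num)]
  simp; ring

theorem Kfun_mono {μ ν r : ℝ} (hr : 0 < r) (h : |μ| ≤ |ν|) : Kfun μ r ≤ Kfun ν r := by
  refine setIntegral_mono_on (kf_integrableOn μ hr) (kf_integrableOn ν hr) measurableSet_Ioi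
    fun l hl => ?_
  gcongr
  rw [Real.cosh_le_cosh, abs_mul, abs_mul]
  gcongr

theorem Kfun_hasDerivAt (μ : ℝ) {r : ℝ} (hr : 0 < r) :
    HasDerivAt (Kfun μ) (-(Kfun (μ + 1) r + Kfun (μ - 1) r) / 2) r := by
  have hid : ∀ l : ℝ, cosh l * cosh (μ * l) = (cosh ((μ + 1) * l) + cosh ((μ - 1) * l)) / 2 := by
    intro l
    rw [add_mul, sub_mul, one_mul, Real.cosh_add, Real.cosh_sub]; ring
  have hIntg : ∀ s : ℝ, 0 < s →
      IntegrableOn (fun l => exp (-(s * cosh l)) * (cosh l * cosh (μ * l))) (Set.Ioi 0) := by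
    intro s hs
    have := ((kf_integrableOn (μ + 1) hs).add (kf_integrableOn (μ - 1) hs)).div_const 2
    refine this.congr (Filter.Eventually.of_forall fun l => ?_)
    simp only [Pi.add_apply, hid]; ring
  have key := hasDerivAt_integral_of_dominated_loc_of_deriv_le
    (μ := volume.restrict (Set.Ioi (0:ℝ))) (s := Set.Ioi (r / 2)) (x₀ := r)
    (F := fun s l => exp (-(s * cosh l)) * cosh (μ * l))
    (F' := fun s l => -(exp (-(s * cosh l)) * (cosh l * cosh (μ * l))))
    (bound := fun l => exp (-(r / 2 * cosh l)) * (cosh l * cosh (μ * l)))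
    (Ioi_mem_nhds (by linarith))
    (Filter.Eventually.of_forall fun s => Continuous.aestronglyMeasurable (by fun_prop))
    (kf_integrableOn μ hr) (Continuous.aestronglyMeasurable (by fun_prop))
    (Filter.Eventually.of_forall fun l s hs => by
      have h1 := Real.cosh_pos l
      have h2 := Real.cosh_pos (μ * l)
      rw [norm_neg, Real.norm_of_nonneg (by positivity)]
      gcongr
      exact le_of_lt hs)
    (hIntg _ (by linarith))
    (Filter.Eventually.of_forall fun l s hs => by
      have : HasDerivAt (fun s : ℝ => -(s * cosh l)) (-(1 * cosh l)) s :=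
        ((hasDerivAt_id s).mul_const _).neg
      refine ((this.exp).mul_const (cosh (μ * l))).congr_deriv ?_
      ring)
  refine key.2.congr_deriv ?_
  symm
  rw [integral_neg, neg_div]
  congr 1
  unfold Kfun
  rw [← integral_add (kf_integrableOn _ hr) (kf_integrableOn _ hr), ← integral_div]
  congr 1; ext l; rw [hid]; ring

/-- coordinate monomials -/
def zmono (α : List (Fin n)) (z : E n) : ℝ := (α.map (fun i => z i)).prod

theorem zmono_cons (i : Fin n) (α : List (Fin n)) (z : E n) :
    zmono (i :: α) z = z i * zmono α z := by simp [zmono]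

theorem coord_le_norm (z : E n) (i : Fin n) : |z i| ≤ ‖z‖ := by
  simpa using PiLp.norm_apply_le z i

theorem zmono_bound (α : List (Fin n)) (z : E n) : |zmono α z| ≤ ‖z‖ ^ α.length := by
  induction α with
  | nil => simp [zmono]
  | cons i α ih =>
    rw [zmono_cons, abs_mul, List.length_cons, pow_succ, mul_comm]
    exact mul_le_mul ih (coord_le_norm z i) (abs_nonneg _) (by positivity)

theorem zmono_continuous (α : List (Fin n)) : Continuous (zmono (n := n) α) := by
  induction α with
  | nil =>
    have : zmono (n := n) [] = fun _ => (1 : ℝ) := by ext z; simp [zmono]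
    rw [this]; exact continuous_const
  | cons i α ih =>
    have : zmono (n := n) (i :: α) = fun z => z i * zmono α z := by
      ext z; exact zmono_cons i α z
    rw [this]
    exact (by fun_prop : Continuous fun z : E n => z i).mul ih

/-- Kernels all of whose moments, and those of its weak gradient, are integrable. -/
structure GoodKer (K : E n → ℝ) : Prop where
  int : ∀ α, Integrable (fun z => zmono α z * K z)
  weak : ∀ j, ∃ D : E n → ℝ, (∀ α, Integrable (fun z => zmono α z * D z)) ∧
    ∀ ψ : E n → ℝ, ContDiff ℝ 1 ψ → HasCompactSupport ψ →
      ∫ z, K z * pd j ψ z = - ∫ z, D z * ψ z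

theorem pd_continuous {ψ : E n → ℝ} (h : ContDiff ℝ 1 ψ) (j : Fin n) : Continuous (pd j ψ) := by
  have := h.continuous_fderiv one_ne_zero
  exact this.clm_apply continuous_const

theorem pd_compact {ψ : E n → ℝ} (h : HasCompactSupport ψ) (j : Fin n) :
    HasCompactSupport (pd j ψ) := by
  have := h.fderiv (𝕜 := ℝ)
  exact this.comp_left (g := fun L : E n →L[ℝ] ℝ => L (EuclideanSpace.single j 1)) (by simp)

theorem hasFDerivAt_coord (i : Fin n) (z : E n) :
    HasFDerivAt (fun z : E n => z i) (EuclideanSpace.proj i : E n →L[ℝ] ℝ) z :=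
  (EuclideanSpace.proj i : E n →L[ℝ] ℝ).hasFDerivAt

theorem pd_coord_mul {ψ : E n → ℝ} (i j : Fin n) {z : E n} (h : DifferentiableAt ℝ ψ z) :
    pd j (fun z => z i * ψ z) z = z i * pd j ψ z + (if i = j then 1 else 0) * ψ z := by
  have : HasFDerivAt (fun z : E n => z i * ψ z) _ z :=
    (hasFDerivAt_coord i z).mul h.hasFDerivAt
  unfold pd
  rw [HasFDerivAt.fderiv this]
  simp

theorem integrable_mul_test {K φ : E n → ℝ} (hK : Integrable K) (hc : Continuous φ)
    (hs : HasCompactSupport φ) : Integrable (fun z => K z * φ z) := by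
  obtain ⟨C, hC⟩ := hc.bounded_above_of_compact_support hs
  exact hK.mul_bdd hc.aestronglyMeasurable (Filter.Eventually.of_forall hC)

theorem GoodKer.integrable {K : E n → ℝ} (h : GoodKer K) : Integrable K := by
  simpa [zmono] using h.int []

theorem GoodKer.coord_mul {K : E n → ℝ} (h : GoodKer K) (i : Fin n) :
    GoodKer (fun z => z i * K z) := by
  refine ⟨fun α => ?_, fun j => ?_⟩
  · refine (h.int (i :: α)).congr (Filter.Eventually.of_forall fun z => ?_)
    simp only [zmono_cons]; ring
  · obtain ⟨D, hD, hw⟩ := h.weak j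
    refine ⟨fun z => (if i = j then 1 else 0) * K z + z i * D z, fun α => ?_, fun ψ hψ hc => ?_⟩
    · refine (((h.int α).const_mul (if i = j then 1 else 0)).add (hD (i :: α))).congr
        (Filter.Eventually.of_forall fun z => ?_)
      simp only [zmono_cons, Pi.add_apply]; ring
    · have hcoord : ContDiff ℝ 1 (fun z : E n => z i) :=
        (EuclideanSpace.proj i : E n →L[ℝ] ℝ).contDiff
      have hc' : HasCompactSupport (fun z : E n => z i * ψ z) := hc.mul_left
      have hψ' : ContDiff ℝ 1 (fun z : E n => z i * ψ z) := hcoord.mul hψ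
      have h1 := hw _ hψ' hc'
      have hDi : Integrable D := by simpa [zmono] using hD []
      have e1 : (fun z => z i * K z * pd j ψ z) =
          fun z => K z * pd j (fun z => z i * ψ z) z
            - (if i = j then 1 else 0) * (K z * ψ z) := by
        ext z
        rw [pd_coord_mul i j (hψ.differentiable one_ne_zero z)]; ring
      have i1 : Integrable (fun z => K z * pd j (fun z => z i * ψ z) z) :=
        integrable_mul_test h.integrable (pd_continuous hψ' j) (pd_compact hc' j)
      have i2 : Integrable (fun z => (if i = j then 1 else 0) * (K z * ψ z)) :=
        (integrable_mul_test h.integrable hψ.continuous hc).const_mul _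
      have i3 : Integrable (fun z => D z * (z i * ψ z)) :=
        integrable_mul_test hDi hψ'.continuous hc'
      rw [e1, integral_sub i1 i2, h1]
      have e2 : (fun z => ((if i = j then 1 else 0) * K z + z i * D z) * ψ z) =
          fun z => (if i = j then 1 else 0) * (K z * ψ z) + D z * (z i * ψ z) := by
        ext z; ring
      rw [e2, integral_add i2 i3]; ring

theorem GoodKer.zmono_mul {K : E n → ℝ} (h : GoodKer K) (α : List (Fin n)) :
    GoodKer (fun z => zmono α z * K z) := by
  induction α with
  | nil => simpa [zmono] using h
  | cons i α ih =>
    have := ih.coord_mul i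
    simpa only [zmono_cons, mul_assoc] using this

theorem integrable_radial (hn : 2 ≤ n) (m : ℕ) {q : ℝ} (hq : -(n : ℝ) < q) :
    Integrable (fun z : E n => ‖z‖ ^ m * (‖z‖ ^ q * exp (-(‖z‖ / 2)))) := by
  have : Nonempty (Fin n) := ⟨⟨0, by omega⟩⟩
  have : Nontrivial (E n) := inferInstance
  rw [integrable_fun_norm_addHaar (volume : Measure (E n))
    (f := fun r => r ^ m * (r ^ q * exp (-(r / 2))))]
  have := integrableOn_rpow_mul_exp_neg_mul_rpow (p := 1) (b := 1 / 2) (s := (n - 1 : ℝ) + m + q)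
    (by have : (0:ℝ) ≤ m := by positivity
        linarith) one_pos (by norm_num)
  refine this.congr_fun (fun r hr => ?_) measurableSet_Ioi
  have hr : 0 < r := hr
  have e : ((n - 1 : ℕ) : ℝ) = (n : ℝ) - 1 := by rw [Nat.cast_sub (by omega)]; simp
  simp only [finrank_euclideanSpace, Fintype.card_fin, smul_eq_mul]
  rw [Real.rpow_add hr, Real.rpow_add hr, ← e, Real.rpow_natCast, Real.rpow_natCast, Real.rpow_one]
  have : -(1 / 2) * r = -(r / 2) := by ring
  rw [this]; ring

theorem bnd_anti {q r s : ℝ} (hq : q ≤ 0) (hr : 0 < r) (h : r ≤ s) :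
    s ^ q * exp (-(s / 2)) ≤ r ^ q * exp (-(r / 2)) := by
  have := Real.rpow_le_rpow_of_nonpos hr h hq
  gcongr

theorem radial_aesm {F : ℝ → ℝ} (hF : ContinuousOn F (Set.Ioi 0)) (hn : 2 ≤ n) :
    AEStronglyMeasurable (fun z : E n => F ‖z‖) volume := by
  have : Nonempty (Fin n) := ⟨⟨0, by omega⟩⟩
  have : Nontrivial (E n) := inferInstance
  rw [← restrict_compl_singleton (μ := (volume : Measure (E n))) 0]
  refine ContinuousOn.aestronglyMeasurable ?_ (measurableSet_singleton _).compl
  exact hF.comp continuous_norm.continuousOn fun z hz => by simpa using hz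

theorem goodKer_radial (hn : 2 ≤ n) {F F' : ℝ → ℝ} {C : ℝ}
    (hF : ∀ r, 0 < r → HasDerivAt F (F' r) r) (hF' : ContinuousOn F' (Set.Ioi 0))
    (hb : ∀ r, 0 < r → |F r| ≤ C * (r ^ (3 / 2 - (n : ℝ)) * exp (-(r / 2))))
    (hb' : ∀ r, 0 < r → |F' r| ≤ C * (r ^ (1 / 2 - (n : ℝ)) * exp (-(r / 2)))) :
    GoodKer (fun z : E n => F ‖z‖) := by
  have : Nonempty (Fin n) := ⟨⟨0, by omega⟩⟩
  have : Nontrivial (E n) := inferInstance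
  have hn' : (2 : ℝ) ≤ n := by exact_mod_cast hn
  have hFc : ContinuousOn F (Set.Ioi 0) := fun r hr =>
    (hF r hr).continuousAt.continuousWithinAt
  have hC : 0 ≤ C := by
    have := (abs_nonneg _).trans (hb 1 one_pos)
    simp only [one_rpow, one_mul] at this
    exact nonneg_of_mul_nonneg_left this (exp_pos _)
  have hne : ∀ᵐ z : E n, z ≠ 0 := by
    simp [ae_iff]
  have gen : ∀ (Q : E n → ℝ) (q : ℝ), -(n : ℝ) < q → AEStronglyMeasurable Q volume →
      (∀ z, z ≠ 0 → |Q z| ≤ C * (‖z‖ ^ q * exp (-(‖z‖ / 2)))) →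
      ∀ α, Integrable (fun z => zmono α z * Q z) := by
    intro Q q hq hm hQ α
    refine ((integrable_radial hn α.length hq).const_mul C).mono'
      ((zmono_continuous α).aestronglyMeasurable.mul hm) ?_
    filter_upwards [hne] with z hz
    rw [Real.norm_eq_abs, abs_mul]
    calc _ ≤ ‖z‖ ^ α.length * (C * (‖z‖ ^ q * exp (-(‖z‖ / 2)))) :=
          mul_le_mul (zmono_bound α z) (hQ z hz) (abs_nonneg _) (by positivity)
      _ = _ := by ring
  have hDm : ∀ j : Fin n, AEStronglyMeasurable (fun z : E n => F' ‖z‖ * (z j / ‖z‖)) volume := by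
    intro j
    refine (radial_aesm hF' hn).mul ?_
    exact Measurable.aestronglyMeasurable (by fun_prop)
  have hDb : ∀ j : Fin n, ∀ z : E n, z ≠ 0 →
      |F' ‖z‖ * (z j / ‖z‖)| ≤ C * (‖z‖ ^ (1 / 2 - (n : ℝ)) * exp (-(‖z‖ / 2))) := by
    intro j z hz
    have hz' := norm_pos_iff.2 hz
    rw [abs_mul]
    refine (mul_le_of_le_one_right (abs_nonneg _) ?_).trans (hb' _ hz')
    rw [abs_div, abs_norm]
    exact div_le_one_of_le₀ (coord_le_norm z j) (norm_nonneg _)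
  refine ⟨gen _ (3 / 2 - n) (by linarith) (radial_aesm hFc hn)
    (fun z hz => hb _ (norm_pos_iff.2 hz)), fun j =>
    ⟨fun z => F' ‖z‖ * (z j / ‖z‖), gen _ (1 / 2 - n) (by linarith) (hDm j) (hDb j), ?_⟩⟩
  intro ψ hψ hc
  obtain ⟨M, hM⟩ := hψ.continuous.bounded_above_of_compact_support hc
  obtain ⟨M', hM'⟩ := (pd_continuous hψ j).bounded_above_of_compact_support (pd_compact hc j)
  -- regularised radius
  set R : ℕ → E n → ℝ := fun k z => √(‖z‖ ^ 2 + (1 / ((k : ℝ) + 1)) ^ 2) with hR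
  have hRpos : ∀ k z, 0 < R k z := fun k z => Real.sqrt_pos.2 (by positivity)
  have hRge : ∀ k z, ‖z‖ ≤ R k z := fun k z => by
    apply Real.le_sqrt_of_sq_le
    have : 0 ≤ (1 / ((k : ℝ) + 1)) ^ 2 := by positivity
    linarith
  have hRcont : ∀ k, Continuous (R k) := fun k => by simp only [hR]; fun_prop
  have hRlim : ∀ z, Filter.Tendsto (fun k => R k z) Filter.atTop (nhds ‖z‖) := by
    intro z
    have h1 : Filter.Tendsto (fun k : ℕ => ‖z‖ ^ 2 + (1 / ((k : ℝ) + 1)) ^ 2) Filter.atTop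
        (nhds (‖z‖ ^ 2 + 0 ^ 2)) :=
      (tendsto_one_div_add_atTop_nhds_zero_nat.pow 2).const_add _
    have h2 := (Real.continuous_sqrt.tendsto _).comp h1
    rw [zero_pow two_ne_zero, add_zero, Real.sqrt_sq (norm_nonneg _)] at h2
    exact h2
  have hder : ∀ k z, HasFDerivAt (fun z => F (R k z))
      (F' (R k z) • ((1 / (2 * R k z)) • ((2 : ℝ) • innerSL ℝ z))) z := by
    intro k z
    have h1 : HasFDerivAt (fun z : E n => ‖z‖ ^ 2 + (1 / ((k : ℝ) + 1)) ^ 2)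
        ((2 : ℝ) • innerSL ℝ z) z := by
      have := (hasStrictFDerivAt_norm_sq z).hasFDerivAt.add_const ((1 / ((k : ℝ) + 1)) ^ 2)
      refine this.congr_fderiv ?_
      ext w; simp
    have h2 := h1.sqrt (by positivity)
    exact (hF _ (hRpos k z)).comp_hasFDerivAt z h2
  have hpd : ∀ k z, fderiv ℝ (fun z => F (R k z)) z (EuclideanSpace.single j 1) =
      F' (R k z) * (z j / R k z) := by
    intro k z
    rw [(hder k z).fderiv]
    have := (hRpos k z).ne'
    simp [EuclideanSpace.inner_single_right]
    left
    field_simp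
  have hFRc : ∀ k, Continuous (fun z => F (R k z)) := fun k =>
    hFc.comp_continuous (hRcont k) (hRpos k)
  have hDRc : ∀ k, Continuous (fun z => F' (R k z) * (z j / R k z)) := fun k =>
    (hF'.comp_continuous (hRcont k) (hRpos k)).mul
      ((by fun_prop : Continuous fun z : E n => z j).div (hRcont k) fun z => (hRpos k z).ne')
  have cs1 : ∀ k, HasCompactSupport (fun z => F (R k z) * pd j ψ z) := fun k =>
    (pd_compact hc j).mul_left
  have cs2 : ∀ k, HasCompactSupport (fun z => F (R k z) * ψ z) := fun k => hc.mul_left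
  have cs3 : ∀ k, HasCompactSupport (fun z => F' (R k z) * (z j / R k z) * ψ z) := fun k =>
    hc.mul_left
  have hibp : ∀ k, ∫ z, F (R k z) * pd j ψ z = - ∫ z, F' (R k z) * (z j / R k z) * ψ z := by
    intro k
    have := integral_mul_fderiv_eq_neg_fderiv_mul_of_integrable (μ := (volume : Measure (E n)))
      (f := fun z => F (R k z)) (g := ψ) (v := EuclideanSpace.single j 1)
      (by simp only [hpd]
          exact ((hDRc k).mul hψ.continuous).integrable_of_hasCompactSupport (cs3 k))
      (((hFRc k).mul (pd_continuous hψ j)).integrable_of_hasCompactSupport (cs1 k))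
      (((hFRc k).mul hψ.continuous).integrable_of_hasCompactSupport (cs2 k))
      (fun z _ => (hder k z).differentiableAt)
      (fun z _ => hψ.differentiable one_ne_zero z)
    simp only [hpd] at this
    exact this
  have l1 : Filter.Tendsto (fun k => ∫ z, F (R k z) * pd j ψ z) Filter.atTop
      (nhds (∫ z, F ‖z‖ * pd j ψ z)) := by
    refine tendsto_integral_of_dominated_convergence
      (fun z => C * (‖z‖ ^ 0 * (‖z‖ ^ (3 / 2 - (n : ℝ)) * exp (-(‖z‖ / 2)))) * M')
      (fun k => ((hFRc k).mul (pd_continuous hψ j)).aestronglyMeasurable)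
      (((integrable_radial hn 0 (by linarith)).const_mul C).mul_const M') ?_ ?_
    · intro k
      filter_upwards [hne] with z hz
      have hz' := norm_pos_iff.2 hz
      rw [norm_mul]
      refine mul_le_mul ?_ (hM' z) (norm_nonneg _) (by positivity)
      rw [pow_zero, one_mul]
      refine (hb _ (hRpos k z)).trans ?_
      exact mul_le_mul_of_nonneg_left (bnd_anti (by linarith) hz' (hRge k z)) hC
    · filter_upwards [hne] with z hz
      have hz' := norm_pos_iff.2 hz
      exact (((hF _ hz').continuousAt.tendsto).comp (hRlim z)).mul_const _
  have l2 : Filter.Tendsto (fun k => ∫ z, F' (R k z) * (z j / R k z) * ψ z) Filter.atTop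
      (nhds (∫ z, F' ‖z‖ * (z j / ‖z‖) * ψ z)) := by
    refine tendsto_integral_of_dominated_convergence
      (fun z => C * (‖z‖ ^ 0 * (‖z‖ ^ (1 / 2 - (n : ℝ)) * exp (-(‖z‖ / 2)))) * M)
      (fun k => ((hDRc k).mul hψ.continuous).aestronglyMeasurable)
      (((integrable_radial hn 0 (by linarith)).const_mul C).mul_const M) ?_ ?_
    · intro k
      filter_upwards [hne] with z hz
      have hz' := norm_pos_iff.2 hz
      rw [norm_mul]
      refine mul_le_mul ?_ (hM z) (norm_nonneg _) (by positivity)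
      rw [pow_zero, one_mul, Real.norm_eq_abs, abs_mul]
      have h1 : |z j / R k z| ≤ 1 := by
        rw [abs_div, abs_of_pos (hRpos k z)]
        exact div_le_one_of_le₀ ((coord_le_norm z j).trans (hRge k z)) (hRpos k z).le
      refine (mul_le_of_le_one_right (abs_nonneg _) h1).trans ((hb' _ (hRpos k z)).trans ?_)
      exact mul_le_mul_of_nonneg_left (bnd_anti (by linarith) hz' (hRge k z)) hC
    · filter_upwards [hne] with z hz
      have hz' := norm_pos_iff.2 hz
      have hca : ContinuousAt F' ‖z‖ := hF'.continuousAt (Ioi_mem_nhds hz')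
      exact ((hca.tendsto.comp (hRlim z)).mul
        (tendsto_const_nhds.div (hRlim z) hz'.ne')).mul_const _
  refine tendsto_nhds_unique l1 ?_
  simp only [hibp]
  exact l2.neg

theorem goodKer_yukawa (hn : 2 ≤ n) {c : ℝ} (hc : 0 < c) : GoodKer (Gyukawa n c) := by
  have hn' : (2 : ℝ) ≤ n := by exact_mod_cast hn
  set ν : ℝ := (n : ℝ) / 2 - 1 with hν
  have hν0 : 0 ≤ ν := by linarith
  have hKc : ∀ μ, ContinuousOn (Kfun μ) (Set.Ioi 0) := fun μ r hr =>
    (Kfun_hasDerivAt μ hr).continuousAt.continuousWithinAt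
  have hpc : ∀ q : ℝ, ContinuousOn (fun r : ℝ => r ^ q) (Set.Ioi 0) := fun q r hr =>
    (Real.continuousAt_rpow_const r q (Or.inl (ne_of_gt hr))).continuousWithinAt
  have B1 : ∀ r, 0 < r → Kfun ν r ≤ 2 * kfA ν * r ^ (-(ν + 1 / 2)) * exp (-(r / 2)) := by
    intro r hr; have := Kfun_bound ν hr; rwa [abs_of_nonneg hν0] at this
  have B2 : ∀ r, 0 < r →
      Kfun (ν + 1) r ≤ 2 * kfA (ν + 1) * r ^ (-(ν + 3 / 2)) * exp (-(r / 2)) := by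
    intro r hr; have := Kfun_bound (ν + 1) hr
    rw [abs_of_nonneg (by linarith : 0 ≤ ν + 1)] at this
    convert this using 4; ring
  have B3 : ∀ r, 0 < r → Kfun (ν - 1) r ≤ Kfun (ν + 1) r := by
    intro r hr
    refine Kfun_mono hr ?_
    rw [abs_of_nonneg (by linarith : 0 ≤ ν + 1), abs_le]
    constructor <;> linarith
  have hA := kfA_nonneg ν
  have hA1 := kfA_nonneg (ν + 1)
  refine goodKer_radial hn
    (F := fun r => c * r ^ ((1 : ℝ) - (n : ℝ) / 2) * Kfun ((n : ℝ) / 2 - 1) r)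
    (F' := fun r => c * ((1 - (n : ℝ) / 2) * r ^ ((1 : ℝ) - (n : ℝ) / 2 - 1)) * Kfun ν r
      + c * r ^ ((1 : ℝ) - (n : ℝ) / 2) * (-(Kfun (ν + 1) r + Kfun (ν - 1) r) / 2))
    (C := c * (2 * kfA ν) + c * (ν * (2 * kfA ν)) + c * (2 * kfA (ν + 1))) ?_ ?_ ?_ ?_
  · intro r hr
    exact (((Real.hasDerivAt_rpow_const (Or.inl hr.ne')).const_mul c).mul (Kfun_hasDerivAt ν hr))
  · exact (((continuousOn_const.mul (continuousOn_const.mul (hpc _))).mul (hKc _))).add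
      ((continuousOn_const.mul (hpc _)).mul
        (((hKc _).add (hKc _)).neg.div_const 2))
  · intro r hr
    rw [← hν, abs_of_nonneg (mul_nonneg (by positivity) (Kfun_nonneg _ _))]
    calc c * r ^ (1 - (n : ℝ) / 2) * Kfun ν r
        ≤ c * r ^ (1 - (n : ℝ) / 2) * (2 * kfA ν * r ^ (-(ν + 1 / 2)) * exp (-(r / 2))) := by
          have := B1 r hr; gcongr
      _ = c * (2 * kfA ν) * ((r ^ (1 - (n : ℝ) / 2) * r ^ (-(ν + 1 / 2))) * exp (-(r / 2))) := by
          ring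
      _ = c * (2 * kfA ν) * (r ^ (3 / 2 - (n : ℝ)) * exp (-(r / 2))) := by
          rw [← Real.rpow_add hr]; congr 3; rw [hν]; ring
      _ ≤ _ := by
          gcongr
          have : 0 ≤ c * (ν * (2 * kfA ν)) := by positivity
          have : 0 ≤ c * (2 * kfA (ν + 1)) := by positivity
          linarith
  · intro r hr
    have hK := Kfun_nonneg ν r
    have hK1 := Kfun_nonneg (ν + 1) r
    have hK2 := Kfun_nonneg (ν - 1) r
    have e1 : |c * ((1 - (n : ℝ) / 2) * r ^ ((1 : ℝ) - (n : ℝ) / 2 - 1)) * Kfun ν r|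
        = c * (ν * r ^ ((1 : ℝ) - (n : ℝ) / 2 - 1)) * Kfun ν r := by
      have : (1 - (n : ℝ) / 2) = -ν := by rw [hν]; ring
      rw [this]
      rw [show c * (-ν * r ^ (-ν - 1)) * Kfun ν r = -(c * (ν * r ^ (-ν - 1)) * Kfun ν r) by ring,
        abs_neg, abs_of_nonneg (by positivity)]
    have e2 : |c * r ^ ((1 : ℝ) - (n : ℝ) / 2) * (-(Kfun (ν + 1) r + Kfun (ν - 1) r) / 2)|
        ≤ c * r ^ ((1 : ℝ) - (n : ℝ) / 2) * Kfun (ν + 1) r := by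
      rw [abs_mul, abs_of_nonneg (by positivity : 0 ≤ c * r ^ ((1 : ℝ) - (n : ℝ) / 2))]
      gcongr
      have := B3 r hr
      rw [abs_le]; constructor <;> linarith
    refine (abs_add_le _ _).trans ?_
    rw [e1]
    refine (add_le_add le_rfl e2).trans ?_
    have f1 : c * (ν * r ^ ((1 : ℝ) - (n : ℝ) / 2 - 1)) * Kfun ν r ≤
        c * (ν * (2 * kfA ν)) * (r ^ (1 / 2 - (n : ℝ)) * exp (-(r / 2))) := by
      calc _ ≤ c * (ν * r ^ ((1 : ℝ) - (n : ℝ) / 2 - 1)) *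
            (2 * kfA ν * r ^ (-(ν + 1 / 2)) * exp (-(r / 2))) := by
            have := B1 r hr; gcongr
        _ = c * (ν * (2 * kfA ν)) *
            ((r ^ ((1 : ℝ) - (n : ℝ) / 2 - 1) * r ^ (-(ν + 1 / 2))) * exp (-(r / 2))) := by ring
        _ = _ := by
            rw [← Real.rpow_add hr]; congr 3; rw [hν]; ring
    have f2 : c * r ^ ((1 : ℝ) - (n : ℝ) / 2) * Kfun (ν + 1) r ≤
        c * (2 * kfA (ν + 1)) * (r ^ (1 / 2 - (n : ℝ)) * exp (-(r / 2))) := by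
      calc _ ≤ c * r ^ ((1 : ℝ) - (n : ℝ) / 2) *
            (2 * kfA (ν + 1) * r ^ (-(ν + 3 / 2)) * exp (-(r / 2))) := by
            have := B2 r hr; gcongr
        _ = c * (2 * kfA (ν + 1)) *
            ((r ^ ((1 : ℝ) - (n : ℝ) / 2) * r ^ (-(ν + 3 / 2))) * exp (-(r / 2))) := by ring
        _ = _ := by
            rw [← Real.rpow_add hr]; congr 3; rw [hν]; ring
    have f3 : 0 ≤ c * (2 * kfA ν) * (r ^ (1 / 2 - (n : ℝ)) * exp (-(r / 2))) := by positivity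
    rw [add_mul, add_mul]
    linarith

/-- unit vectors -/
abbrev ee (i : Fin n) : E n := EuclideanSpace.single i (1 : ℝ)

/-- macroscopic vector fields as vectors -/
def mvf (t : ℝ) (Z : VFIdx n) (x : E n) : E n :=
  match Z with
  | Sum.inl i => ee i
  | Sum.inr (Sum.inl i) => t • ee i
  | Sum.inr (Sum.inr (Sum.inl p)) => x p.1.1 • ee p.1.2 - x p.1.2 • ee p.1.1
  | Sum.inr (Sum.inr (Sum.inr _)) => ∑ i, x i • ee i

/-- velocity part of the microscopic vector fields -/
def vvf (Z : VFIdx n) (v : E n) : E n :=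
  match Z with
  | Sum.inl _ => 0
  | Sum.inr (Sum.inl i) => ee i
  | Sum.inr (Sum.inr (Sum.inl p)) => v p.1.1 • ee p.1.2 - v p.1.2 • ee p.1.1
  | Sum.inr (Sum.inr (Sum.inr _)) => ∑ i, v i • ee i

/-- microscopic vector field at fixed time -/
def mA (t : ℝ) (Z : VFIdx n) (g : E n × E n → ℝ) (p : E n × E n) : ℝ :=
  fderiv ℝ g p (mvf t Z p.1, vvf Z p.2)

/-- compositions -/
def mL (t : ℝ) (L : List (VFIdx n)) (g : E n × E n → ℝ) : E n × E n → ℝ :=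
  L.foldr (mA t) g

/-- test functions -/
def Cc (g : E n × E n → ℝ) : Prop := ContDiff ℝ (⊤ : ℕ∞) g ∧ HasCompactSupport g

theorem mvf_contDiff (t : ℝ) (Z : VFIdx n) : ContDiff ℝ (⊤ : ℕ∞) (mvf t Z) := by
  rcases Z with i | i | p | u <;> unfold mvf <;> dsimp only <;> fun_prop

theorem vvf_contDiff (Z : VFIdx n) : ContDiff ℝ (⊤ : ℕ∞) (vvf Z) := by
  rcases Z with i | i | p | u <;> unfold vvf <;> dsimp only <;> fun_prop

theorem Cc.mA {g : E n × E n → ℝ} (h : Cc g) (t : ℝ) (Z : VFIdx n) : Cc (mA t Z g) := by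
  constructor
  · have h1 : ContDiff ℝ (⊤ : ℕ∞) (fderiv ℝ g) := h.1.fderiv_right (by simp)
    have h2 : ContDiff ℝ (⊤ : ℕ∞) (fun p : E n × E n => (mvf t Z p.1, vvf Z p.2)) :=
      ((mvf_contDiff t Z).comp contDiff_fst).prodMk ((vvf_contDiff Z).comp contDiff_snd)
    exact h1.clm_apply h2
  · have := h.2.fderiv (𝕜 := ℝ)
    refine this.mono ?_
    intro p hp
    rw [Function.mem_support] at hp ⊢
    intro h0
    apply hp
    unfold _root_.mA
    rw [h0]; rfl

theorem Cc.mL {g : E n × E n → ℝ} (h : Cc g) (t : ℝ) (L : List (VFIdx n)) : Cc (mL t L g) := by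
  induction L with
  | nil => exact h
  | cons Z L ih => exact ih.mA t Z

theorem Cc.diff {g : E n × E n → ℝ} (h : Cc g) : Differentiable ℝ g :=
  h.1.differentiable (by simp)

theorem Cc.continuous {g : E n × E n → ℝ} (h : Cc g) : Continuous g := h.1.continuous

theorem pd_fst {g : E n × E n → ℝ} (h : Differentiable ℝ g) (i : Fin n) (x v : E n) :
    pd i (fun y => g (y, v)) x = fderiv ℝ g (x, v) (ee i, 0) := by
  have h1 : HasFDerivAt (fun y : E n => (y, v)) (ContinuousLinearMap.inl ℝ (E n) (E n)) x :=
    hasFDerivAt_prodMk_left x v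
  have := (h (x, v)).hasFDerivAt.comp x h1
  unfold pd
  rw [show (fun y => g (y, v)) = g ∘ fun y => (y, v) from rfl, this.fderiv]
  simp

theorem pd_snd {g : E n × E n → ℝ} (h : Differentiable ℝ g) (i : Fin n) (x v : E n) :
    pd i (fun w => g (x, w)) v = fderiv ℝ g (x, v) (0, ee i) := by
  have h1 : HasFDerivAt (fun y : E n => (x, y)) (ContinuousLinearMap.inr ℝ (E n) (E n)) v :=
    hasFDerivAt_prodMk_right x v
  have := (h (x, v)).hasFDerivAt.comp v h1
  unfold pd
  rw [show (fun y => g (x, y)) = g ∘ fun y => (x, y) from rfl, this.fderiv]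
  simp

theorem fderiv_split (g : E n × E n → ℝ) (p : E n × E n) (a b : E n) :
    fderiv ℝ g p (a, b) = fderiv ℝ g p (a, 0) + fderiv ℝ g p (0, b) := by
  rw [← map_add]; simp

theorem fderiv_smul_fst (g : E n × E n → ℝ) (p : E n × E n) (s : ℝ) (a : E n) :
    fderiv ℝ g p (s • a, 0) = s * fderiv ℝ g p (a, 0) := by
  rw [← smul_eq_mul, ← map_smul]; simp

theorem fderiv_smul_snd (g : E n × E n → ℝ) (p : E n × E n) (s : ℝ) (a : E n) :
    fderiv ℝ g p (0, s • a) = s * fderiv ℝ g p (0, a) := by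
  rw [← smul_eq_mul, ← map_smul]; simp

theorem fderiv_sub_fst (g : E n × E n → ℝ) (p : E n × E n) (a b : E n) :
    fderiv ℝ g p (a - b, 0) = fderiv ℝ g p (a, 0) - fderiv ℝ g p (b, 0) := by
  rw [← map_sub]; simp

theorem fderiv_sub_snd (g : E n × E n → ℝ) (p : E n × E n) (a b : E n) :
    fderiv ℝ g p (0, a - b) = fderiv ℝ g p (0, a) - fderiv ℝ g p (0, b) := by
  rw [← map_sub]; simp

theorem fderiv_sum_fst (g : E n × E n → ℝ) (p : E n × E n) (a : Fin n → E n) :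
    fderiv ℝ g p (∑ i, a i, 0) = ∑ i, fderiv ℝ g p (a i, 0) := by
  exact map_sum ((fderiv ℝ g p).comp (ContinuousLinearMap.inl ℝ (E n) (E n))) a Finset.univ

theorem fderiv_sum_snd (g : E n × E n → ℝ) (p : E n × E n) (a : Fin n → E n) :
    fderiv ℝ g p (0, ∑ i, a i) = ∑ i, fderiv ℝ g p (0, a i) := by
  exact map_sum ((fderiv ℝ g p).comp (ContinuousLinearMap.inr ℝ (E n) (E n))) a Finset.univ

/-- pointwise formula for the microscopic fields in coordinates -/
theorem microApply_eq (t : ℝ) (Z : VFIdx n) (F : ℝ → E n → E n → ℝ) (g : E n × E n → ℝ)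
    (hg : Differentiable ℝ g) (hF : F t = fun x v => g (x, v)) (x v : E n) :
    microApply Z F t x v = mA t Z g (x, v) := by
  rcases Z with i | i | p | u
  · simp only [microApply, hF, mA, mvf, vvf, pd_fst hg]
  · simp only [microApply, hF, mA, mvf, vvf, pd_fst hg, pd_snd hg]
    rw [fderiv_split g (x, v) (t • ee i), fderiv_smul_fst]
  · simp only [microApply, hF, mA, mvf, vvf, pd_fst hg, pd_snd hg]
    rw [fderiv_split g (x, v) (_ - _), fderiv_sub_fst, fderiv_sub_snd]
    simp only [fderiv_smul_fst, fderiv_smul_snd]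
    ring
  · simp only [microApply, hF, mA, mvf, vvf, pd_fst hg, pd_snd hg]
    rw [fderiv_split g (x, v) (∑ i, _), fderiv_sum_fst, fderiv_sum_snd]
    simp only [fderiv_smul_fst, fderiv_smul_snd]

theorem microList_eq (t : ℝ) (L : List (VFIdx n)) (f : E n → E n → ℝ)
    (hf : Cc (fun p : E n × E n => f p.1 p.2)) :
    microList L (fun _ z w => f z w) t = fun x v => mL t L (fun p => f p.1 p.2) (x, v) := by
  induction L with
  | nil => rfl
  | cons Z L ih =>
    ext x v
    exact microApply_eq t Z _ _ (hf.mL t L).diff ih x v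

theorem macroApply_eq (t : ℝ) (Z : VFIdx n) (Φ : ℝ → E n → ℝ) (x : E n) :
    macroApply Z Φ t x = fderiv ℝ (Φ t) x (mvf t Z x) := by
  rcases Z with i | i | p | u <;> simp [macroApply, mvf, pd]

/-! velocity averages -/

/-- velocity average at fixed time -/
def rhoP (g : E n × E n → ℝ) (x : E n) : ℝ := ∫ v : E n, g (x, v)

theorem Cc.section_cs {F : Type*} [Zero F] {g : E n × E n → F} (h : HasCompactSupport g) :
    ∃ k : Set (E n), IsCompact k ∧ ∀ x v, v ∉ k → g (x, v) = 0 := by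
  refine ⟨Prod.snd '' tsupport g, h.isCompact.image continuous_snd, fun x v hv => ?_⟩
  by_contra h0
  exact hv ⟨(x, v), subset_tsupport _ h0, rfl⟩

theorem section_hcs {F : Type*} [Zero F] {g : E n × E n → F}
    (h : HasCompactSupport g) (x : E n) : HasCompactSupport (fun v => g (x, v)) := by
  obtain ⟨k, hk, h0⟩ := Cc.section_cs h
  exact HasCompactSupport.intro hk fun v hv => h0 x v hv

theorem rhoP_hasFDerivAt {g : E n × E n → ℝ} (h : Cc g) (x : E n) :
    HasFDerivAt (rhoP g)
      (∫ v, (fderiv ℝ g (x, v)).comp (ContinuousLinearMap.inl ℝ (E n) (E n))) x := by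
  have hd : Continuous (fderiv ℝ g) := h.1.continuous_fderiv (by simp)
  have hdc := h.2.fderiv (𝕜 := ℝ)
  obtain ⟨k, hk, h0⟩ := Cc.section_cs hdc
  obtain ⟨M, hM⟩ := hd.bounded_above_of_compact_support hdc
  have hcomp : ∀ x, Continuous fun v : E n =>
      (fderiv ℝ g (x, v)).comp (ContinuousLinearMap.inl ℝ (E n) (E n)) := fun x =>
    (hd.comp (by fun_prop : Continuous fun v : E n => (x, v))).clm_comp continuous_const
  refine hasFDerivAt_integral_of_dominated_of_fderiv_le (s := Set.univ)
    (F := fun y v => g (y, v))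
    (F' := fun y v => (fderiv ℝ g (y, v)).comp (ContinuousLinearMap.inl ℝ (E n) (E n)))
    (bound := k.indicator fun _ => M * ‖ContinuousLinearMap.inl ℝ (E n) (E n)‖) Filter.univ_mem
    (Filter.Eventually.of_forall fun y => Continuous.aestronglyMeasurable ?_)
    ?_ (hcomp x).aestronglyMeasurable ?_ ?_ ?_
  · exact h.continuous.comp (by fun_prop)
  · exact (h.continuous.comp (by fun_prop : Continuous fun v : E n => (x, v))
      ).integrable_of_hasCompactSupport (section_hcs h.2 x)
  · refine Filter.Eventually.of_forall fun v y _ => ?_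
    by_cases hv : v ∈ k
    · rw [Set.indicator_of_mem hv]
      refine (ContinuousLinearMap.opNorm_comp_le _ _).trans ?_
      gcongr
      exact hM _
    · rw [Set.indicator_of_notMem hv, h0 y v hv]; simp
  · exact (integrable_indicator_iff hk.measurableSet).2 (integrableOn_const hk.measure_ne_top)
  · refine Filter.Eventually.of_forall fun v y _ => ?_
    exact (h.diff (y, v)).hasFDerivAt.comp y (hasFDerivAt_prodMk_left y v)

theorem rhoP_fderiv {g : E n × E n → ℝ} (h : Cc g) (x w : E n) :
    fderiv ℝ (rhoP g) x w = ∫ v, fderiv ℝ g (x, v) (w, 0) := by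
  have hd : Continuous (fderiv ℝ g) := h.1.continuous_fderiv (by simp)
  have hdc := h.2.fderiv (𝕜 := ℝ)
  rw [(rhoP_hasFDerivAt h x).fderiv, ContinuousLinearMap.integral_apply]
  · simp
  · refine Continuous.integrable_of_hasCompactSupport ?_ ?_
    · exact (hd.comp (by fun_prop : Continuous fun v : E n => (x, v))).clm_comp continuous_const
    · exact (section_hcs hdc x).comp_left
        (g := fun L : E n × E n →L[ℝ] ℝ => L.comp (ContinuousLinearMap.inl ℝ (E n) (E n))) (by simp)

theorem rhoP_contDiff {g : E n × E n → ℝ} (h : Cc g) : ContDiff ℝ 1 (rhoP g) := by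
  have hd : Continuous (fderiv ℝ g) := h.1.continuous_fderiv (by simp)
  have hdc := h.2.fderiv (𝕜 := ℝ)
  obtain ⟨k, hk, h0⟩ := Cc.section_cs hdc
  rw [contDiff_one_iff_fderiv]
  refine ⟨fun x => (rhoP_hasFDerivAt h x).differentiableAt, ?_⟩
  have : fderiv ℝ (rhoP g) = fun x =>
      ∫ v, (fderiv ℝ g (x, v)).comp (ContinuousLinearMap.inl ℝ (E n) (E n)) := by
    ext1 x; exact (rhoP_hasFDerivAt h x).fderiv
  rw [this, ← continuousOn_univ]
  refine continuousOn_integral_of_compact_support hk (Continuous.continuousOn ?_) ?_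
  · exact hd.clm_comp continuous_const
  · intro x v _ hv
    rw [h0 x v hv]; simp

theorem rhoP_cs {g : E n × E n → ℝ} (h : Cc g) : HasCompactSupport (rhoP g) := by
  refine HasCompactSupport.intro (h.2.isCompact.image continuous_fst) fun x hx => ?_
  have : ∀ v, g (x, v) = 0 := fun v => by
    by_contra h0
    exact hx ⟨(x, v), subset_tsupport _ h0, rfl⟩
  simp [rhoP, this]

theorem sec_cont {g : E n × E n → ℝ} (h : Cc g) (x : E n) : Continuous fun v => g (x, v) :=
  h.continuous.comp (by fun_prop)

theorem sec_contDiff {g : E n × E n → ℝ} (h : Cc g) (x : E n) :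
    ContDiff ℝ 1 fun v => g (x, v) :=
  (h.1.of_le (by exact_mod_cast le_top)).comp (contDiff_prodMk_right x)

theorem sec_int {g : E n × E n → ℝ} (h : Cc g) (x : E n) : Integrable fun v => g (x, v) :=
  (sec_cont h x).integrable_of_hasCompactSupport (section_hcs h.2 x)

theorem fd_int {g : E n × E n → ℝ} (h : Cc g) (x : E n) (a b : E n → E n)
    (ha : Continuous a) (hb : Continuous b) :
    Integrable fun v => fderiv ℝ g (x, v) (a v, b v) := by
  have hd : Continuous (fderiv ℝ g) := h.1.continuous_fderiv (by simp)
  have hdc := h.2.fderiv (𝕜 := ℝ)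
  refine Continuous.integrable_of_hasCompactSupport ?_ ?_
  · exact (hd.comp (by fun_prop : Continuous fun v : E n => (x, v))).clm_apply (ha.prodMk hb)
  · refine (section_hcs hdc x).mono fun v hv => ?_
    rw [Function.mem_support] at hv ⊢
    intro h0; apply hv; rw [h0]; rfl

theorem int_dv {g : E n × E n → ℝ} (h : Cc g) (x : E n) (j : Fin n) :
    ∫ v, fderiv ℝ g (x, v) (0, ee j) = 0 := by
  have := integral_mul_fderiv_eq_neg_fderiv_mul_of_integrable (μ := (volume : Measure (E n)))
    (f := fun _ => (1 : ℝ)) (g := fun v => g (x, v)) (v := ee j)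
    (by simp) (by
      have := fd_int h x (fun _ => 0) (fun _ => ee j) continuous_const continuous_const
      simp only [one_mul]
      refine this.congr (Filter.Eventually.of_forall fun v => ?_)
      exact (pd_snd h.diff j x v).symm) (by simpa using sec_int h x)
    (fun z _ => by fun_prop)
    (fun z _ => (sec_contDiff h x).differentiable one_ne_zero z)
  simp only [one_mul, fderiv_fun_const, Pi.zero_apply, zero_apply, zero_mul,
    integral_zero, neg_zero] at this
  rw [← this]
  congr 1; ext v
  exact (pd_snd h.diff j x v).symm

theorem int_vdv {g : E n × E n → ℝ} (h : Cc g) (x : E n) (i j : Fin n) :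
    ∫ v : E n, v i * fderiv ℝ g (x, v) (0, ee j) = -((if i = j then 1 else 0) * rhoP g x) := by
  have hc : ∀ v : E n, fderiv ℝ (fun v : E n => v i) v (ee j) = if i = j then 1 else 0 := by
    intro v
    rw [(hasFDerivAt_coord i v).fderiv]; simp
  have := integral_mul_fderiv_eq_neg_fderiv_mul_of_integrable (μ := (volume : Measure (E n)))
    (f := fun v => v i) (g := fun v => g (x, v)) (v := ee j)
    (by simp only [hc]; exact (sec_int h x).const_mul _) (by
      have := fd_int h x (fun _ => 0) (fun v => v i • ee j) continuous_const (by fun_prop)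
      refine this.congr (Filter.Eventually.of_forall fun v => ?_)
      simp only [fderiv_smul_snd]
      congr 1
      exact (pd_snd h.diff j x v).symm)
    (by
      refine Continuous.integrable_of_hasCompactSupport
        ((by fun_prop : Continuous fun v : E n => v i).mul (sec_cont h x)) ?_
      exact (section_hcs h.2 x).mul_left)
    (fun z _ => (hasFDerivAt_coord i z).differentiableAt)
    (fun z _ => (sec_contDiff h x).differentiable one_ne_zero z)
  simp only [hc, integral_const_mul] at this
  rw [show rhoP g x = ∫ v, g (x, v) from rfl, ← this]
  congr 1; ext v
  congr 1
  exact (pd_snd h.diff j x v).symm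

/-- the constant arising from the divergence of the velocity part -/
def cZ (Z : VFIdx n) : ℝ :=
  match Z with
  | Sum.inr (Sum.inr (Sum.inr _)) => n
  | _ => 0

theorem int_vvf {g : E n × E n → ℝ} (h : Cc g) (x : E n) (Z : VFIdx n) :
    ∫ v, fderiv ℝ g (x, v) (0, vvf Z v) = -(cZ Z * rhoP g x) := by
  have hi : ∀ i j : Fin n, Integrable fun v : E n => v i * fderiv ℝ g (x, v) (0, ee j) := by
    intro i j
    have := fd_int h x (fun _ => 0) (fun v => v i • ee j) continuous_const (by fun_prop)
    simpa only [fderiv_smul_snd] using this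
  rcases Z with i | i | p | u
  · have : ∀ v, fderiv ℝ g (x, v) (0, 0) = 0 := fun v => map_zero _
    simp [vvf, cZ, this]
  · simp only [vvf, cZ, int_dv h]; simp
  · simp only [vvf, cZ, fderiv_sub_snd, fderiv_smul_snd]
    rw [integral_sub (hi _ _) (hi _ _), int_vdv h, int_vdv h, if_neg (ne_of_lt p.2),
      if_neg (ne_of_gt p.2)]
    simp
  · simp only [vvf, cZ, fderiv_sum_snd, fderiv_smul_snd]
    rw [integral_finsetSum _ fun i _ => hi i i]
    simp only [int_vdv h, if_true]
    simp

theorem rhoP_comm {g : E n × E n → ℝ} (h : Cc g) (t : ℝ) (Z : VFIdx n) (x : E n) :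
    fderiv ℝ (rhoP g) x (mvf t Z x) = rhoP (mA t Z g) x + cZ Z * rhoP g x := by
  have : rhoP (mA t Z g) x = fderiv ℝ (rhoP g) x (mvf t Z x) - cZ Z * rhoP g x := by
    rw [rhoP_fderiv h, sub_eq_add_neg, ← int_vvf h, ← integral_add]
    · unfold rhoP mA
      congr 1; ext v; exact fderiv_split _ _ _ _
    · exact fd_int h x _ _ continuous_const continuous_const
    · exact fd_int h x _ _ continuous_const (vvf_contDiff Z).continuous
  rw [this]; ring

theorem Cc.integrable {g : E n × E n → ℝ} (h : Cc g) :
    Integrable g ((volume : Measure (E n)).prod (volume : Measure (E n))) :=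
  h.continuous.integrable_of_hasCompactSupport h.2

/-- affine parametrisation of the leaf through `(x,v)` -/
def aff (a b : ℝ) (x v : E n) (y : Fin n → ℝ) : E n × E n :=
  (x + a • WithLp.toLp 2 y, v + b • WithLp.toLp 2 y)

theorem toLp_update (y : Fin n → ℝ) (d : Fin n) (s : ℝ) :
    (WithLp.toLp 2 (Function.update y d s) : E n) =
      WithLp.toLp 2 (Function.update y d 0) + s • ee d := by
  ext i
  by_cases h : i = d
  · subst h; simp
  · simp [h]

theorem aff_continuous (a b : ℝ) (x v : E n) : Continuous (aff a b x v) := by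
  unfold aff; fun_prop

theorem one_step {u : E n × E n → ℝ} (h : Cc u) {a b : ℝ} (ha : a ≠ 0) (x v : E n)
    (y : Fin n → ℝ) (d : Fin n) :
    ‖u (aff a b x v y)‖ₑ ≤
      ∫⁻ s, ‖fderiv ℝ u (aff a b x v (Function.update y d s)) (a • ee d, b • ee d)‖ₑ := by
  set p₀ := aff a b x v (Function.update y d 0) with hp
  have hline : ∀ s : ℝ, aff a b x v (Function.update y d s) = p₀ + s • (a • ee d, b • ee d) := by
    intro s
    simp only [hp, aff, toLp_update y d s, Prod.smul_mk, Prod.mk_add_mk]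
    congr 1 <;> module
  have hcd : ContDiff ℝ 1 (fun s : ℝ => u (p₀ + s • (a • ee d, b • ee d))) :=
    (h.1.of_le (by exact_mod_cast le_top)).comp (by fun_prop)
  have hcs : HasCompactSupport (fun s : ℝ => u (p₀ + s • (a • ee d, b • ee d))) := by
    refine HasCompactSupport.intro (h.2.isCompact.image
      (by fun_prop : Continuous fun p : E n × E n => (p.1 d - p₀.1 d) / a)) fun s hs => ?_
    by_contra h0
    refine hs ⟨_, subset_tsupport _ h0, ?_⟩
    simp
    field_simp
  have hder : ∀ s : ℝ, deriv (fun s : ℝ => u (p₀ + s • (a • ee d, b • ee d))) s =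
      fderiv ℝ u (p₀ + s • (a • ee d, b • ee d)) (a • ee d, b • ee d) := by
    intro s
    have h1 : HasDerivAt (fun s : ℝ => p₀ + s • (a • ee d, b • ee d))
        ((1 : ℝ) • (a • ee d, b • ee d)) s :=
      ((hasDerivAt_id s).smul_const _).const_add _
    have := (h.diff _).hasFDerivAt.comp_hasDerivAt s h1
    rw [one_smul] at this
    exact this.deriv
  have key := HasCompactSupport.enorm_le_lintegral_Ici_deriv hcd hcs (y d)
  rw [← hline, Function.update_eq_self] at key
  refine key.trans ((setLIntegral_le_lintegral _ _).trans (le_of_eq ?_))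
  simp only [hder, hline]

theorem multi_step (t : ℝ) {a b : ℝ} (ha : a ≠ 0) (Zf : Fin n → VFIdx n)
    (hZ : ∀ d x v, mvf t (Zf d) x = a • ee d ∧ vvf (Zf d) v = b • ee d)
    {g : E n × E n → ℝ} (h : Cc g) (x v : E n) (ds : List (Fin n)) (hds : ds.Nodup) :
    ∀ y, ‖g (aff a b x v y)‖ₑ ≤ lmarginal (fun _ => (volume : Measure ℝ)) ds.toFinset
      (fun y => ‖mL t (ds.map Zf) g (aff a b x v y)‖ₑ) y := by
  induction ds with
  | nil => intro y; simp [mL]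
  | cons d ds ih =>
    intro y
    rw [List.nodup_cons] at hds
    refine (ih hds.2 y).trans ?_
    have hc := h.mL t (ds.map Zf)
    have hm : Measurable (fun y => ‖mL t ((d :: ds).map Zf) g (aff a b x v y)‖ₑ) :=
      (((h.mL t ((d :: ds).map Zf)).continuous.comp (aff_continuous a b x v)).enorm).measurable
    have hdisj : Disjoint ds.toFinset {d} := by
      simpa using hds.1
    have hun : (d :: ds).toFinset = ds.toFinset ∪ {d} := by
      ext i; simp [or_comm]
    rw [hun, lmarginal_union _ _ hm hdisj]
    refine lmarginal_mono (fun y' => ?_) y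
    rw [lmarginal_singleton]
    refine (one_step hc ha x v y' d).trans (le_of_eq ?_)
    congr 1; ext s
    simp only [List.map_cons, mL, List.foldr_cons, mA]
    rw [(hZ d _ 0).1, (hZ d 0 _).2]

theorem sobolev_decay (t : ℝ) {a b : ℝ} (ha : 0 < a) (Zf : Fin n → VFIdx n)
    (hZ : ∀ d x v, mvf t (Zf d) x = a • ee d ∧ vvf (Zf d) v = b • ee d)
    {g : E n × E n → ℝ} (h : Cc g) (x : E n) :
    a ^ n * ∫ v, |g (x, v)| ≤ ∫ z, ∫ v, |mL t ((List.finRange n).map Zf) g (z, v)| := by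
  set H := mL t ((List.finRange n).map Zf) g with hH
  have hHc : Cc H := h.mL t _
  have hHm : Continuous H := hHc.continuous
  -- pointwise bound
  have p1 : ∀ v, ‖g (x, v)‖ₑ ≤ ∫⁻ y : E n, ‖H (x + a • y, v + b • y)‖ₑ := by
    intro v
    have := multi_step t ha.ne' Zf hZ h x v (List.finRange n) (List.nodup_finRange n) 0
    have e0 : aff a b x v 0 = (x, v) := by simp [aff]
    rw [e0, List.toFinset_finRange, lmarginal_univ, ← volume_pi] at this
    refine this.trans (le_of_eq ?_)
    exact (PiLp.volume_preserving_toLp (Fin n)).lintegral_comp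
      (f := fun y : E n => ‖H (x + a • y, v + b • y)‖ₑ) (by
        apply Continuous.measurable; fun_prop)
  set k : E n → ℝ := fun z => ∫ v, |H (z, v)| with hk
  have hkint : Integrable k := hHc.integrable.norm.integral_prod_left
  have hk0 : ∀ z, 0 ≤ k z := fun z => integral_nonneg fun v => abs_nonneg _
  have hkint2 : Integrable (fun y : E n => k (x + a • y)) := by
    have := (hkint.comp_add_left x).comp_smul ha.ne'
    exact this
  have kl : ∀ (G : E n × E n → ℝ), Cc G → ∀ z,
      ∫⁻ v, ‖G (z, v)‖ₑ = ENNReal.ofReal (∫ v, |G (z, v)|) := by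
    intro G hG z
    rw [ofReal_integral_eq_lintegral_ofReal (sec_int hG z).abs
      (Filter.Eventually.of_forall fun v => abs_nonneg _)]
    simp only [← Real.enorm_abs (G _), Real.enorm_of_nonneg (abs_nonneg _)]
  have p2 : ENNReal.ofReal (∫ v, |g (x, v)|) ≤ ENNReal.ofReal ((a ^ n)⁻¹ * ∫ z, k z) := by
    rw [← kl g h x]
    calc ∫⁻ v, ‖g (x, v)‖ₑ ≤ ∫⁻ v, ∫⁻ y : E n, ‖H (x + a • y, v + b • y)‖ₑ := lintegral_mono p1
      _ = ∫⁻ y : E n, ∫⁻ v, ‖H (x + a • y, v + b • y)‖ₑ := by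
          refine lintegral_lintegral_swap ?_
          apply Measurable.aemeasurable
          apply Continuous.measurable
          unfold Function.uncurry; fun_prop
      _ = ∫⁻ y : E n, ∫⁻ v, ‖H (x + a • y, v)‖ₑ := by
          congr 1; ext y
          exact lintegral_add_right_eq_self (fun v => ‖H (x + a • y, v)‖ₑ) (b • y)
      _ = ∫⁻ y : E n, ENNReal.ofReal (k (x + a • y)) := by
          congr 1; ext y; exact kl H hHc _
      _ = ENNReal.ofReal (∫ y : E n, k (x + a • y)) :=
          (ofReal_integral_eq_lintegral_ofReal hkint2
            (Filter.Eventually.of_forall fun y => hk0 _)).symm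
      _ = _ := by
          congr 1
          rw [Measure.integral_comp_smul volume (fun y => k (x + y)) a,
            integral_add_left_eq_self]
          simp [abs_of_pos ha]
  have hnn : 0 ≤ (a ^ n)⁻¹ * ∫ z, k z := mul_nonneg (by positivity) (integral_nonneg hk0)
  have p3 := (ENNReal.ofReal_le_ofReal_iff hnn).1 p2
  rwa [← div_eq_inv_mul, le_div_iff₀ (by positivity), mul_comm] at p3

/-- `L¹` norm of a composition -/
def nL (t : ℝ) (L : List (VFIdx n)) (g : E n × E n → ℝ) : ℝ := ∫ x, ∫ v, |mL t L g (x, v)|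

theorem mL_append (t : ℝ) (L L' : List (VFIdx n)) (g : E n × E n → ℝ) :
    mL t (L ++ L') g = mL t L (mL t L' g) := by simp [mL]

/-- decay of velocity averages; `En` bounds all the norms of order at most `N` -/
theorem decay {t : ℝ} (ht : 0 ≤ t) {g : E n × E n → ℝ} (h : Cc g) {N : ℕ} {En : ℝ}
    (hE : ∀ L : List (VFIdx n), L.length ≤ N → nL t L g ≤ En)
    (L : List (VFIdx n)) (hL : L.length + n ≤ N) (x : E n) :
    ∫ v, |mL t L g (x, v)| ≤ 2 ^ n * En / (1 + t) ^ n := by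
  have main : ∃ a : ℝ, 1 + t ≤ 2 * a ∧ 0 < a ∧ a ^ n * ∫ v, |mL t L g (x, v)| ≤ En := by
    by_cases h1 : 1 ≤ t
    · refine ⟨t, by linarith, by linarith, ?_⟩
      refine (sobolev_decay t (a := t) (b := 1) (by linarith)
        (fun d => Sum.inr (Sum.inl d)) (fun d x v => ⟨rfl, by simp [vvf]⟩) (h.mL t L) x).trans ?_
      rw [← mL_append]
      exact hE _ (by simp; omega)
    · refine ⟨1, by linarith, by linarith, ?_⟩
      refine (sobolev_decay t (a := 1) (b := 0) (by linarith)
        (fun d => Sum.inl d) (fun d x v => ⟨by simp [mvf], by simp [vvf]⟩) (h.mL t L) x).trans ?_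
      rw [← mL_append]
      exact hE _ (by simp; omega)
  obtain ⟨a, h1, h2, h3⟩ := main
  have hI : 0 ≤ ∫ v, |mL t L g (x, v)| := integral_nonneg fun v => abs_nonneg _
  rw [le_div_iff₀ (by positivity)]
  calc _ ≤ (∫ v, |mL t L g (x, v)|) * (2 * a) ^ n := by gcongr
    _ = 2 ^ n * (a ^ n * ∫ v, |mL t L g (x, v)|) := by rw [mul_pow]; ring
    _ ≤ _ := by gcongr

theorem conv_eq_mul (K h : E n → ℝ) :
    conv K h = convolution K h (ContinuousLinearMap.mul ℝ ℝ) volume := by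
  funext x
  rw [convolution_mul_swap]
  rfl

theorem conv_integrand {K h : E n → ℝ} (hK : Integrable K) (hc : Continuous h)
    (hs : HasCompactSupport h) (x : E n) : Integrable (fun y => K (x - y) * h y) :=
  integrable_mul_test (hK.comp_sub_left x) hc hs

theorem conv_hasFDerivAt {K h : E n → ℝ} (hK : Integrable K) (hh : ContDiff ℝ 1 h)
    (hs : HasCompactSupport h) (x : E n) :
    DifferentiableAt ℝ (conv K h) x ∧
      ∀ w, fderiv ℝ (conv K h) x w = conv K (fun y => fderiv ℝ h y w) x := by
  have H := hs.hasFDerivAt_convolution_right (ContinuousLinearMap.mul ℝ ℝ)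
    hK.locallyIntegrable hh x
  rw [← conv_eq_mul] at H
  refine ⟨H.differentiableAt, fun w => ?_⟩
  rw [H.fderiv]
  rw [convolution_precompR_apply (ContinuousLinearMap.mul ℝ ℝ) hK.locallyIntegrable (hs.fderiv ℝ)
    (hh.continuous_fderiv one_ne_zero) x w, ← conv_eq_mul]

theorem conv_add {K h k : E n → ℝ} (hK : Integrable K) (hc : Continuous h)
    (hs : HasCompactSupport h) (kc : Continuous k) (ks : HasCompactSupport k) (x : E n) :
    conv K (fun y => h y + k y) x = conv K h x + conv K k x := by
  unfold conv
  rw [← integral_add (conv_integrand hK hc hs x) (conv_integrand hK kc ks x)]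
  simp only [mul_add]

theorem conv_smul (K h : E n → ℝ) (c : ℝ) (x : E n) :
    conv K (fun y => c * h y) x = c * conv K h x := by
  unfold conv
  rw [← integral_const_mul]
  congr 1; funext y; ring

theorem coord_conv {K h : E n → ℝ} (hK : GoodKer K) (hc : Continuous h)
    (hs : HasCompactSupport h) (i : Fin n) (x : E n) :
    x i * conv K h x = conv (fun z => z i * K z) h x + conv K (fun y => y i * h y) x := by
  have h1 := conv_integrand (hK.coord_mul i).integrable hc hs x
  have h2 := conv_integrand (h := fun y => y i * h y) hK.integrable (by fun_prop) (hs.mul_left) x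
  unfold conv
  rw [← integral_const_mul, ← integral_add h1 h2]
  congr 1; funext y
  simp only [PiLp.sub_apply]; ring

theorem conv_weak {K D h : E n → ℝ} (j : Fin n)
    (hD : ∀ ψ, ContDiff ℝ 1 ψ → HasCompactSupport ψ → ∫ z, K z * pd j ψ z = - ∫ z, D z * ψ z)
    (hh : ContDiff ℝ 1 h) (hs : HasCompactSupport h) (x : E n) :
    conv K (pd j h) x = conv D h x := by
  have h1 := hD (fun z => h (x - z)) (hh.comp (by fun_prop))
    (hs.comp_homeomorph (Homeomorph.subLeft x))
  have h2 : ∀ z, pd j (fun z => h (x - z)) z = - pd j h (x - z) := by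
    intro z
    unfold pd
    have := ((hh.differentiable one_ne_zero (x - z)).hasFDerivAt.comp z
      ((hasFDerivAt_id z).const_sub x)).fderiv
    change fderiv ℝ (fun z => h (x - z)) z = _ at this
    rw [this]; simp
  simp only [h2] at h1
  have e : ∀ (A B : E n → ℝ), conv A B x = ∫ z, A z * B (x - z) := by
    intro A B
    unfold conv
    rw [← integral_sub_left_eq_self _ volume x]
    simp
  rw [e, e]
  simp only [mul_neg, integral_neg, neg_inj] at h1
  exact h1

theorem conv_sup {D h : E n → ℝ} (hD : Integrable D) {M : ℝ} (hM : ∀ y, |h y| ≤ M) (x : E n) :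
    |conv D h x| ≤ (∫ z, |D z|) * M := by
  unfold conv
  rw [← integral_sub_left_eq_self (fun z => |D z|) volume x, ← integral_mul_const]
  refine (abs_integral_le_integral_abs).trans ?_
  refine integral_mono_of_nonneg (.of_forall fun _ => abs_nonneg _)
    ((hD.comp_sub_left x).abs.mul_const M) (.of_forall fun y => ?_)
  simp only [abs_mul]
  exact mul_le_mul_of_nonneg_left (hM y) (abs_nonneg _)

theorem conv_int {D h : E n → ℝ} (hD : Integrable D) (hh : Integrable h) :
    Integrable (conv D h) ∧ ∫ x, |conv D h x| ≤ (∫ z, |D z|) * ∫ y, |h y| := by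
  have i1 : Integrable (conv D h) := by
    rw [conv_eq_mul]; exact hD.integrable_convolution _ hh
  have i2 : Integrable (conv (fun z => |D z|) (fun z => |h z|)) := by
    rw [conv_eq_mul]; exact hD.abs.integrable_convolution _ hh.abs
  refine ⟨i1, ?_⟩
  have := integral_convolution (ContinuousLinearMap.mul ℝ ℝ) hD.abs hh.abs
    (μ := volume) (ν := volume)
  rw [← conv_eq_mul] at this
  simp only [ContinuousLinearMap.mul_apply'] at this
  rw [← this]
  refine integral_mono i1.abs i2 fun x => ?_
  unfold conv
  refine (abs_integral_le_integral_abs).trans (le_of_eq ?_)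
  simp only [abs_mul]

theorem pd_rhoP {g : E n × E n → ℝ} (h : Cc g) (t : ℝ) (j : Fin n) :
    (fun y => fderiv ℝ (rhoP g) y (ee j)) = rhoP (mA t (Sum.inl j) g) := by
  funext y
  have := rhoP_comm h t (Sum.inl j) y
  simpa [mvf, cZ] using this

theorem rhoP_continuous {g : E n × E n → ℝ} (h : Cc g) : Continuous (rhoP g) :=
  (rhoP_contDiff h).continuous

/-- remainder terms -/
def remT (t : ℝ) (K : E n → ℝ) (g : E n × E n → ℝ) (Z : VFIdx n) (x : E n) : ℝ :=
  match Z with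
  | Sum.inl _ => 0
  | Sum.inr (Sum.inl _) => 0
  | Sum.inr (Sum.inr (Sum.inl p)) =>
      conv (fun z => z p.1.1 * K z) (rhoP (mA t (Sum.inl p.1.2) g)) x -
      conv (fun z => z p.1.2 * K z) (rhoP (mA t (Sum.inl p.1.1) g)) x
  | Sum.inr (Sum.inr (Sum.inr _)) =>
      ∑ i, conv (fun z => z i * K z) (rhoP (mA t (Sum.inl i) g)) x

theorem conv_sum {K : E n → ℝ} (hK : Integrable K) (h : Fin n → E n → ℝ)
    (hc : ∀ i, Continuous (h i)) (hs : ∀ i, HasCompactSupport (h i)) (x : E n) :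
    conv K (fun y => ∑ i, h i y) x = ∑ i, conv K (h i) x := by
  unfold conv
  rw [← integral_finsetSum _ fun i _ => conv_integrand hK (hc i) (hs i) x]
  simp only [Finset.mul_sum]

theorem step_aux {K : E n → ℝ} (hK : GoodKer K) {g : E n × E n → ℝ} (h : Cc g) (t : ℝ)
    (Z : VFIdx n) (x : E n) :
    fderiv ℝ (conv K (rhoP g)) x (mvf t Z x) =
      conv K (fun y => fderiv ℝ (rhoP g) y (mvf t Z y)) x + remT t K g Z x := by
  have H := (conv_hasFDerivAt hK.integrable (rhoP_contDiff h) (rhoP_cs h) x).2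
  have cc : ∀ j, Continuous (rhoP (mA t (Sum.inl j) g)) := fun j => rhoP_continuous (h.mA _ _)
  have cs : ∀ j, HasCompactSupport (rhoP (mA t (Sum.inl j) g)) := fun j => rhoP_cs (h.mA _ _)
  have P := fun j (y : E n) => congrFun (pd_rhoP h t j) y
  have He : ∀ j, fderiv ℝ (conv K (rhoP g)) x (ee j) = conv K (rhoP (mA t (Sum.inl j) g)) x := by
    intro j; rw [H, pd_rhoP h t]
  have Q : ∀ i j, x i * conv K (rhoP (mA t (Sum.inl j) g)) x = _ :=
    fun i j => coord_conv hK (cc j) (cs j) i x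
  rcases Z with i | i | p | u
  · simp only [mvf, remT, H, add_zero]
  · simp only [mvf, remT, H, add_zero]
  · simp only [mvf, remT, map_sub, map_smul, He, P, smul_eq_mul, Q]
    have := conv_add hK.integrable (h := fun y => y p.1.1 * rhoP (mA t (Sum.inl p.1.2) g) y)
      (k := fun y => (-1) * (y p.1.2 * rhoP (mA t (Sum.inl p.1.1) g) y))
      ((by fun_prop : Continuous fun y : E n => y p.1.1).mul (cc _)) (cs _).mul_left
      (continuous_const.mul ((by fun_prop : Continuous fun y : E n => y p.1.2).mul (cc _)))
      (cs _).mul_left.mul_left x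
    rw [conv_smul] at this
    have e : ∀ y : E n, y p.1.1 * rhoP (mA t (Sum.inl p.1.2) g) y -
      y p.1.2 * rhoP (mA t (Sum.inl p.1.1) g) y = y p.1.1 * rhoP (mA t (Sum.inl p.1.2) g) y +
      (-1) * (y p.1.2 * rhoP (mA t (Sum.inl p.1.1) g) y) := fun y => by ring
    simp only [e]
    rw [this]; ring
  · simp only [mvf, remT, map_sum, map_smul, He, P, smul_eq_mul, Q]
    rw [conv_sum hK.integrable (fun i (y : E n) => y i * rhoP (mA t (Sum.inl i) g) y)
      (fun i => (by fun_prop : Continuous fun y : E n => y i).mul (cc _))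
      (fun i => (cs _).mul_left), Finset.sum_add_distrib, add_comm]

theorem step_main {K : E n → ℝ} (hK : GoodKer K) {g : E n × E n → ℝ} (h : Cc g) (t : ℝ)
    (Z : VFIdx n) (x : E n) :
    fderiv ℝ (conv K (rhoP g)) x (mvf t Z x) =
      conv K (rhoP (mA t Z g)) x + cZ Z * conv K (rhoP g) x + remT t K g Z x := by
  rw [step_aux hK h]
  simp only [rhoP_comm h]
  rw [conv_add hK.integrable (rhoP_continuous (h.mA t Z)) (rhoP_cs (h.mA t Z))
    (k := fun y => cZ Z * rhoP g y)
    (continuous_const.mul (rhoP_continuous h)) (rhoP_cs h).mul_left, conv_smul]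

/-- one term of the expansion of `Z^γ φ` -/
def trm (G : E n → ℝ) (t : ℝ) (f : E n × E n → ℝ) (τ : ℝ × List (Fin n) × List (VFIdx n))
    (x : E n) : ℝ :=
  τ.1 * conv (fun z => zmono τ.2.1 z * G z) (rhoP (mL t τ.2.2 f)) x

/-- action of a vector field on a term -/
def stepT (Z : VFIdx n) (τ : ℝ × List (Fin n) × List (VFIdx n)) :
    List (ℝ × List (Fin n) × List (VFIdx n)) :=
  (τ.1, τ.2.1, Z :: τ.2.2) :: (τ.1 * cZ Z, τ.2.1, τ.2.2) ::
  match Z with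
  | Sum.inl _ => []
  | Sum.inr (Sum.inl _) => []
  | Sum.inr (Sum.inr (Sum.inl p)) =>
      [(τ.1, p.1.1 :: τ.2.1, Sum.inl p.1.2 :: τ.2.2),
       (-τ.1, p.1.2 :: τ.2.1, Sum.inl p.1.1 :: τ.2.2)]
  | Sum.inr (Sum.inr (Sum.inr _)) =>
      (List.finRange n).map fun i => (τ.1, i :: τ.2.1, Sum.inl i :: τ.2.2)

/-- the expansion -/
def expand : List (VFIdx n) → List (ℝ × List (Fin n) × List (VFIdx n))
  | [] => [(1, [], [])]
  | Z :: L => (expand L).flatMap (stepT Z)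

theorem stepT_length (Z : VFIdx n) (τ σ : ℝ × List (Fin n) × List (VFIdx n))
    (h : σ ∈ stepT Z τ) : σ.2.2.length ≤ τ.2.2.length + 1 := by
  rcases Z with i | i | p | u <;> simp only [stepT, List.mem_cons, List.mem_map, List.not_mem_nil] at h
  · rcases h with rfl | rfl | h
    · simp
    · simp
    · simp at h
  · rcases h with rfl | rfl | h
    · simp
    · simp
    · simp at h
  · rcases h with rfl | rfl | rfl | rfl | h
    · simp
    · simp
    · simp
    · simp
    · simp at h
  · rcases h with rfl | rfl | ⟨a, _, rfl⟩
    · simp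
    · simp
    · simp

theorem expand_length (L : List (VFIdx n)) (τ) (h : τ ∈ expand L) : τ.2.2.length ≤ L.length := by
  induction L generalizing τ with
  | nil => simp [expand] at h; subst h; simp
  | cons Z L ih =>
    simp only [expand, List.mem_flatMap] at h
    obtain ⟨σ, h1, h2⟩ := h
    have := stepT_length _ _ _ h2
    have := ih _ h1
    simp; omega

theorem trm_differentiableAt {G : E n → ℝ} (hG : GoodKer G) {f : E n × E n → ℝ} (h : Cc f) (t : ℝ)
    (τ) (x : E n) : DifferentiableAt ℝ (trm G t f τ) x :=
  ((conv_hasFDerivAt (hG.zmono_mul τ.2.1).integrable (rhoP_contDiff (h.mL t τ.2.2))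
    (rhoP_cs (h.mL t τ.2.2)) x).1).const_mul _

theorem trm_fderiv {G : E n → ℝ} (hG : GoodKer G) {f : E n × E n → ℝ} (h : Cc f) (t : ℝ)
    (τ) (x w : E n) : fderiv ℝ (trm G t f τ) x w =
      τ.1 * fderiv ℝ (conv (fun z => zmono τ.2.1 z * G z) (rhoP (mL t τ.2.2 f))) x w := by
  have := fderiv_const_mul ((conv_hasFDerivAt (hG.zmono_mul τ.2.1).integrable
    (rhoP_contDiff (h.mL t τ.2.2)) (rhoP_cs (h.mL t τ.2.2)) x).1) τ.1
  change fderiv ℝ (trm G t f τ) x = _ at this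
  rw [this]; rfl

theorem trm_step {G : E n → ℝ} (hG : GoodKer G) {f : E n × E n → ℝ} (h : Cc f) (t : ℝ)
    (Z : VFIdx n) (τ) (x : E n) :
    fderiv ℝ (trm G t f τ) x (mvf t Z x) = ((stepT Z τ).map (fun σ => trm G t f σ x)).sum := by
  rw [trm_fderiv hG h, step_main (hG.zmono_mul τ.2.1) (h.mL t τ.2.2)]
  rcases Z with i | i | p | u
  · simp only [stepT, List.map_cons, List.map_nil, List.sum_cons, List.sum_nil, trm, remT]
    simp only [mL, List.foldr_cons]; ring
  · simp only [stepT, List.map_cons, List.map_nil, List.sum_cons, List.sum_nil, trm, remT]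
    simp only [mL, List.foldr_cons]; ring
  · simp only [stepT, List.map_cons, List.map_nil, List.sum_cons, List.sum_nil, trm, remT,
      zmono_cons, mul_assoc]
    simp only [mL, List.foldr_cons]; ring
  · simp only [stepT, List.map_cons, List.map_map, List.sum_cons, trm, remT,
      zmono_cons, mul_assoc, Function.comp_def]
    rw [← List.ofFn_eq_map, List.sum_ofFn, ← Finset.mul_sum]
    simp only [mL, List.foldr_cons]; ring

theorem fderiv_list_sum {ι : Type*} (l : List ι) (F : ι → E n → ℝ) (x : E n)
    (hF : ∀ i, DifferentiableAt ℝ (F i) x) :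
    DifferentiableAt ℝ (fun y => (l.map (fun i => F i y)).sum) x ∧
    ∀ w, fderiv ℝ (fun y => (l.map (fun i => F i y)).sum) x w =
      (l.map (fun i => fderiv ℝ (F i) x w)).sum := by
  induction l with
  | nil => simp
  | cons a l ih =>
    simp only [List.map_cons, List.sum_cons]
    refine ⟨(hF a).add ih.1, fun w => ?_⟩
    have := fderiv_add (hF a) ih.1
    change fderiv ℝ (fun y => F a y + (l.map (fun i => F i y)).sum) x = _ at this
    rw [this, _root_.add_apply, ih.2]

theorem sum_flatMap' {ι κ : Type*} (l : List ι) (s : ι → List κ) (F : κ → ℝ) :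
    ((l.flatMap s).map F).sum = (l.map fun i => ((s i).map F).sum).sum := by
  induction l with
  | nil => simp
  | cons a l ih => simp [ih]

theorem macro_expand {G : E n → ℝ} (hG : GoodKer G) {f : E n × E n → ℝ} (h : Cc f) (t : ℝ)
    (L : List (VFIdx n)) :
    macroList L (fun _ z => conv G (rhoP f) z) t =
      fun x => ((expand L).map (fun τ => trm G t f τ x)).sum := by
  induction L with
  | nil => funext x; simp [macroList, expand, trm, mL, zmono]
  | cons Z L ih =>
    funext x
    have e : macroList (Z :: L) (fun _ z => conv G (rhoP f) z) =
      macroApply Z (macroList L (fun _ z => conv G (rhoP f) z)) := rfl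
    rw [e, macroApply_eq, ih,
      (fderiv_list_sum (expand L) (trm G t f) x fun τ => trm_differentiableAt hG h t τ x).2]
    simp only [trm_step hG h, expand, sum_flatMap']

theorem norm_le_sum_ee (A : E n →L[ℝ] ℝ) : ‖A‖ ≤ ∑ j, |A (ee j)| := by
  refine A.opNorm_le_bound (Finset.sum_nonneg fun _ _ => abs_nonneg _) fun w => ?_
  have hw : w = ∑ j, w j • ee j := by
    ext i
    simp [Finset.sum_apply, Pi.single_apply]
  have : A w = ∑ j, w j * A (ee j) := by
    conv_lhs => rw [hw]
    simp
  rw [this, Real.norm_eq_abs, Finset.sum_mul]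
  refine (Finset.abs_sum_le_sum_abs _ _).trans (Finset.sum_le_sum fun j _ => ?_)
  rw [abs_mul, mul_comm]
  exact mul_le_mul_of_nonneg_left (coord_le_norm w j) (abs_nonneg _)

theorem trm_bound {G : E n → ℝ} (hG : GoodKer G) (τ : ℝ × List (Fin n) × List (VFIdx n)) :
    ∃ C : ℝ, 0 ≤ C ∧ ∀ (t : ℝ) (f : E n × E n → ℝ), Cc f →
      (∀ M, (∀ y, |rhoP (mL t τ.2.2 f) y| ≤ M) →
        ∀ x, ∑ j, |fderiv ℝ (trm G t f τ) x (ee j)| ≤ C * M) ∧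
      Integrable (fun x => ∑ j, |fderiv ℝ (trm G t f τ) x (ee j)|) ∧
      ∫ x, ∑ j, |fderiv ℝ (trm G t f τ) x (ee j)| ≤ C * ∫ y, |rhoP (mL t τ.2.2 f) y| := by
  choose D hDi hDw using (hG.zmono_mul τ.2.1).weak
  have hDI : ∀ j, Integrable (D j) := fun j => by simpa [zmono] using hDi j []
  refine ⟨∑ j, |τ.1| * ∫ z, |D j z|, Finset.sum_nonneg fun j _ => mul_nonneg (abs_nonneg _)
    (integral_nonneg fun _ => abs_nonneg _), fun t f h => ?_⟩
  have hc := h.mL t τ.2.2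
  have key : ∀ j x, |fderiv ℝ (trm G t f τ) x (ee j)| =
      |τ.1| * |conv (D j) (rhoP (mL t τ.2.2 f)) x| := by
    intro j x
    rw [trm_fderiv hG h, (conv_hasFDerivAt (hG.zmono_mul τ.2.1).integrable (rhoP_contDiff hc)
      (rhoP_cs hc) x).2, abs_mul]
    congr 2
    exact conv_weak j (hDw j) (rhoP_contDiff hc) (rhoP_cs hc) x
  simp only [key]
  have hI := fun j => conv_int (hDI j)
    ((rhoP_continuous hc).integrable_of_hasCompactSupport (rhoP_cs hc))
  refine ⟨fun M hM x => ?_, ?_, ?_⟩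
  · rw [Finset.sum_mul]
    refine Finset.sum_le_sum fun j _ => ?_
    rw [mul_assoc]
    exact mul_le_mul_of_nonneg_left (conv_sup (hDI j) hM x) (abs_nonneg _)
  · exact integrable_finsetSum _ fun j _ => (hI j).1.abs.const_mul _
  · rw [integral_finsetSum _ fun j _ => (hI j).1.abs.const_mul _, Finset.sum_mul]
    refine Finset.sum_le_sum fun j _ => ?_
    rw [mul_assoc, integral_const_mul]
    exact mul_le_mul_of_nonneg_left (hI j).2 (abs_nonneg _)

theorem abs_rhoP_le (g : E n × E n → ℝ) (x : E n) : |rhoP g x| ≤ ∫ v, |g (x, v)| :=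
  abs_integral_le_integral_abs

theorem absInt_integrable {g : E n × E n → ℝ} (h : Cc g) :
    Integrable fun x => ∫ v, |g (x, v)| :=
  h.integrable.abs.integral_prod_left

theorem rhoP_L1 {g : E n × E n → ℝ} (h : Cc g) : ∫ x, |rhoP g x| ≤ ∫ x, ∫ v, |g (x, v)| :=
  integral_mono_of_nonneg (.of_forall fun _ => abs_nonneg _) (absInt_integrable h)
    (.of_forall fun x => abs_rhoP_le g x)

theorem list_bound {G : E n → ℝ} (hG : GoodKer G) (k : ℕ)
    (l : List (ℝ × List (Fin n) × List (VFIdx n))) (hl : ∀ τ ∈ l, τ.2.2.length ≤ k) :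
    ∃ C : ℝ, 0 ≤ C ∧ ∀ (t : ℝ) (f : E n × E n → ℝ) (N : ℕ) (En : ℝ), 0 ≤ t → Cc f →
      (∀ L : List (VFIdx n), L.length ≤ N → nL t L f ≤ En) →
      (k + n ≤ N → ∀ x, ‖fderiv ℝ (fun y => (l.map fun τ => trm G t f τ y).sum) x‖ ≤
        C * (En / (1 + t) ^ n)) ∧
      (k ≤ N → ∃ m : E n → ℝ, Integrable m ∧
        (∀ x, ‖fderiv ℝ (fun y => (l.map fun τ => trm G t f τ y).sum) x‖ ≤ m x) ∧
        ∫ x, m x ≤ C * En) := by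
  induction l with
  | nil =>
    refine ⟨0, le_rfl, fun t f N En ht h hE => ⟨fun _ x => by simp, fun _ =>
      ⟨fun _ => 0, integrable_zero _ _ _, fun x => by simp, by simp⟩⟩⟩
  | cons τ l ih =>
    obtain ⟨C₁, hC₁, H₁⟩ := ih fun σ hσ => hl σ (List.mem_cons_of_mem _ hσ)
    obtain ⟨C₂, hC₂, H₂⟩ := trm_bound hG τ
    have hk : τ.2.2.length ≤ k := hl τ List.mem_cons_self
    refine ⟨C₂ * 2 ^ n + C₁, by positivity, fun t f N En ht h hE => ?_⟩
    obtain ⟨A, B⟩ := H₁ t f N En ht h hE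
    obtain ⟨A', I', B'⟩ := H₂ t f h
    have hd : ∀ x, ‖fderiv ℝ (fun y => ((τ :: l).map fun τ => trm G t f τ y).sum) x‖ ≤
        ∑ j, |fderiv ℝ (trm G t f τ) x (ee j)| +
        ‖fderiv ℝ (fun y => (l.map fun τ => trm G t f τ y).sum) x‖ := by
      intro x
      simp only [List.map_cons, List.sum_cons]
      have d1 := trm_differentiableAt hG h t τ x
      have d2 := (fderiv_list_sum l (trm G t f) x fun τ => trm_differentiableAt hG h t τ x).1
      have := fderiv_add d1 d2
      change fderiv ℝ (fun y => trm G t f τ y + (l.map (fun i => trm G t f i y)).sum) x = _ at this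
      rw [this]
      exact (norm_add_le _ _).trans (add_le_add (norm_le_sum_ee _) le_rfl)
    have hEn : 0 ≤ En := le_trans
      (integral_nonneg fun x => integral_nonneg fun v => abs_nonneg _) (hE [] (by simp))
    refine ⟨fun hN x => ?_, fun hN => ?_⟩
    · refine (hd x).trans ?_
      rw [add_mul]
      refine add_le_add ?_ (A hN x)
      refine (A' (2 ^ n * En / (1 + t) ^ n) (fun y => (abs_rhoP_le _ y).trans
        (decay ht h hE τ.2.2 (by omega) y)) x).trans (le_of_eq ?_)
      ring
    · obtain ⟨m, hm, hm1, hm2⟩ := B hN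
      refine ⟨_, I'.add hm, fun x => (hd x).trans (add_le_add le_rfl (hm1 x)), ?_⟩
      have e := integral_add I' hm
      refine (le_of_eq e).trans ?_
      rw [add_mul]
      refine add_le_add (B'.trans ?_) hm2
      rw [mul_assoc]
      refine mul_le_mul_of_nonneg_left ?_ hC₂
      have h1 := (rhoP_L1 (h.mL t τ.2.2)).trans (hE τ.2.2 (by omega))
      have : (1 : ℝ) ≤ 2 ^ n := one_le_pow₀ (by norm_num)
      nlinarith

theorem macro_bound {G : E n → ℝ} (hG : GoodKer G) (L : List (VFIdx n)) :
    ∃ C : ℝ, 0 ≤ C ∧ ∀ (t : ℝ) (f : E n × E n → ℝ) (N : ℕ) (En : ℝ), 0 ≤ t → Cc f →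
      (∀ L : List (VFIdx n), L.length ≤ N → nL t L f ≤ En) →
      (L.length + n ≤ N → ∀ x,
        ‖fderiv ℝ (macroList L (fun _ z => conv G (rhoP f) z) t) x‖ ≤ C * (En / (1 + t) ^ n)) ∧
      (L.length ≤ N → ∃ m : E n → ℝ, Integrable m ∧
        (∀ x, ‖fderiv ℝ (macroList L (fun _ z => conv G (rhoP f) z) t) x‖ ≤ m x) ∧
        ∫ x, m x ≤ C * En) := by
  obtain ⟨C, hC, H⟩ := list_bound hG L.length (expand L) (expand_length L)
  refine ⟨C, hC, fun t f N En ht h hE => ?_⟩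
  rw [macro_expand hG h]
  exact H t f N En ht h hE

theorem pair_bound {G : E n → ℝ} (hG : GoodKer G) (N : ℕ) (hN : 2 * n ≤ N) (L : List (VFIdx n)) :
    ∃ C : ℝ, 0 ≤ C ∧ ∀ (t : ℝ) (f : E n × E n → ℝ) (En : ℝ), 0 ≤ t → Cc f →
      (∀ L : List (VFIdx n), L.length ≤ N → nL t L f ≤ En) →
      ∀ M : List (VFIdx n), L.length ≤ N → M.length ≤ N → L.length + M.length ≤ N + 1 →
      ∫ x, ∫ v, ‖fderiv ℝ (macroList L (fun _ z => conv G (rhoP f) z) t) x‖ * |mL t M f (x, v)| ≤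
        C * (En * En / (1 + t) ^ n) := by
  obtain ⟨C, hC, H⟩ := macro_bound hG L
  refine ⟨2 ^ n * C, by positivity, fun t f En ht h hE M hL hM hLM => ?_⟩
  obtain ⟨A, B⟩ := H t f N En ht h hE
  have hEn : 0 ≤ En := le_trans
    (integral_nonneg fun x => integral_nonneg fun v => abs_nonneg _) (hE [] (by simp))
  simp only [integral_const_mul]
  have n0 : ∀ x, 0 ≤ ∫ v, |mL t M f (x, v)| := fun x => integral_nonneg fun v => abs_nonneg _
  have h2 : (1 : ℝ) ≤ 2 ^ n := one_le_pow₀ (by norm_num)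
  by_cases hc : L.length + n ≤ N
  · have h1 : ∫ x, ‖fderiv ℝ (macroList L (fun _ z => conv G (rhoP f) z) t) x‖ *
        ∫ v, |mL t M f (x, v)| ≤ ∫ x, (C * (En / (1 + t) ^ n)) * ∫ v, |mL t M f (x, v)| :=
      integral_mono_of_nonneg (.of_forall fun x => mul_nonneg (norm_nonneg _) (n0 x))
        ((absInt_integrable (h.mL t M)).const_mul _)
        (.of_forall fun x => mul_le_mul_of_nonneg_right (A hc x) (n0 x))
    refine h1.trans ?_
    rw [integral_const_mul]
    have h3 := hE M hM
    unfold nL at h3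
    calc _ ≤ C * (En / (1 + t) ^ n) * En := mul_le_mul_of_nonneg_left h3 (by positivity)
      _ = 1 * (C * (En * En / (1 + t) ^ n)) := by ring
      _ ≤ 2 ^ n * (C * (En * En / (1 + t) ^ n)) :=
        mul_le_mul_of_nonneg_right h2 (by positivity)
      _ = _ := by ring
  · obtain ⟨m, hm, hm1, hm2⟩ := B hL
    have h1 : ∫ x, ‖fderiv ℝ (macroList L (fun _ z => conv G (rhoP f) z) t) x‖ *
        ∫ v, |mL t M f (x, v)| ≤ ∫ x, m x * (2 ^ n * En / (1 + t) ^ n) :=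
      integral_mono_of_nonneg (.of_forall fun x => mul_nonneg (norm_nonneg _) (n0 x))
        (hm.mul_const _)
        (.of_forall fun x => mul_le_mul (hm1 x) (decay ht h hE M (by omega) x) (n0 x)
          ((norm_nonneg _).trans (hm1 x)))
    refine h1.trans ?_
    rw [integral_mul_const]
    calc _ ≤ (C * En) * (2 ^ n * En / (1 + t) ^ n) :=
          mul_le_mul_of_nonneg_right hm2 (by positivity)
      _ = _ := by ring

/-- bilinear estimate `‖∇ₓ(Z^γ φ) Z^β f‖_{L¹} ≲ ε (1+t)^{-n} 𝓔_N[f]`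
for the Vlasov–Yukawa potential `φ = G₁ * ρ(f)`. -/
theorem bilinear_estimate_vlasov_yukawa (n N : ℕ) (hn : 2 ≤ n) (hN : 2 * n ≤ N)
    (c' : ℝ) (hc' : 0 < c') :
    ∃ C : ℝ, 0 < C ∧
      ∀ t : ℝ, 0 ≤ t → ∀ ε : ℝ, 0 < ε →
      ∀ f : E n → E n → ℝ,
        ContDiff ℝ (⊤ : ℕ∞) (fun p : E n × E n => f p.1 p.2) →
        HasCompactSupport (fun p : E n × E n => f p.1 p.2) →
        (∑ m ∈ Finset.range (N + 1), ∑ α : Fin m → VFIdx n,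
            ∫ x : E n, ∫ v : E n,
              |microList (List.ofFn α) (fun _ z w => f z w) t x v|) ≤ 2 * ε →
        ∀ kγ kβ : ℕ, kγ ≤ N → kβ ≤ N → kγ + kβ ≤ N + 1 →
        ∀ (γ : Fin kγ → VFIdx n) (β : Fin kβ → VFIdx n),
          (∫ x : E n, ∫ v : E n,
              ‖fderiv ℝ
                  (macroList (List.ofFn γ)
                    (fun _ z => ∫ y : E n, Gyukawa n c' (z - y) *
                      ∫ w : E n, f y w) t) x‖ *
                |microList (List.ofFn β) (fun _ z w => f z w) t x v|) ≤
            C * ε / (1 + t) ^ n *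
              ∑ m ∈ Finset.range (N + 1), ∑ α : Fin m → VFIdx n,
                ∫ x : E n, ∫ v : E n,
                  |microList (List.ofFn α) (fun _ z w => f z w) t x v| := by

  have hG := goodKer_yukawa hn hc'
  choose CL hCL H using fun L : List (VFIdx n) => pair_bound hG N hN L
  have hS0 : ∀ k, 0 ≤ ∑ γ : Fin k → VFIdx n, CL (List.ofFn γ) :=
    fun k => Finset.sum_nonneg fun γ _ => hCL _
  refine ⟨2 * (∑ k ∈ Finset.range (N + 1), ∑ γ : Fin k → VFIdx n, CL (List.ofFn γ)) + 1,
    by have := Finset.sum_nonneg fun k (_ : k ∈ Finset.range (N + 1)) => hS0 k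
       linarith, ?_⟩
  intro t ht ε hε f hf1 hf2 hEε kγ kβ hkγ hkβ hk γ β
  have hf : Cc (fun p : E n × E n => f p.1 p.2) := ⟨hf1, hf2⟩
  have hm := fun L : List (VFIdx n) => microList_eq t L f hf
  set En := ∑ m ∈ Finset.range (N + 1), ∑ α : Fin m → VFIdx n,
    ∫ x : E n, ∫ v : E n, |microList (List.ofFn α) (fun _ z w => f z w) t x v| with hEn
  have hE : ∀ L : List (VFIdx n), L.length ≤ N → nL t L (fun p : E n × E n => f p.1 p.2) ≤ En := by
    intro L hL
    have h1 : nL t L (fun p : E n × E n => f p.1 p.2) =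
        ∫ x : E n, ∫ v : E n, |microList (List.ofFn L.get) (fun _ z w => f z w) t x v| := by
      rw [List.ofFn_get, hm]; rfl
    rw [h1, hEn]
    have nn : ∀ (m : ℕ) (α : Fin m → VFIdx n),
        0 ≤ ∫ x : E n, ∫ v : E n, |microList (List.ofFn α) (fun _ z w => f z w) t x v| :=
      fun m α => integral_nonneg fun x => integral_nonneg fun v => abs_nonneg _
    refine le_trans ?_ (Finset.single_le_sum (f := fun m => ∑ α : Fin m → VFIdx n,
      ∫ x : E n, ∫ v : E n, |microList (List.ofFn α) (fun _ z w => f z w) t x v|)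
      (fun m _ => Finset.sum_nonneg fun α _ => nn m α)
      (Finset.mem_range.2 (Nat.lt_succ_of_le hL)))
    exact Finset.single_le_sum (f := fun α : Fin L.length → VFIdx n =>
      ∫ x : E n, ∫ v : E n, |microList (List.ofFn α) (fun _ z w => f z w) t x v|)
      (fun α _ => nn _ α) (Finset.mem_univ L.get)
  have hEn0 : 0 ≤ En := le_trans
    (integral_nonneg fun x => integral_nonneg fun v => abs_nonneg _) (hE [] (by simp))
  have key := H (List.ofFn γ) t _ En ht hf hE (List.ofFn β) (by simpa) (by simpa) (by simpa)
  have hC1 : CL (List.ofFn γ) ≤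
      ∑ k ∈ Finset.range (N + 1), ∑ γ : Fin k → VFIdx n, CL (List.ofFn γ) :=
    (Finset.single_le_sum (f := fun γ : Fin kγ → VFIdx n => CL (List.ofFn γ))
      (fun γ _ => hCL _) (Finset.mem_univ γ)).trans
    (Finset.single_le_sum (f := fun k => ∑ γ : Fin k → VFIdx n, CL (List.ofFn γ))
      (fun k _ => hS0 k) (Finset.mem_range.2 (Nat.lt_succ_of_le hkγ)))
  rw [hm]
  refine le_trans key ?_
  set S := ∑ k ∈ Finset.range (N + 1), ∑ γ : Fin k → VFIdx n, CL (List.ofFn γ)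
  have hS : 0 ≤ S := (hCL _).trans hC1
  have hp : 0 < (1 + t) ^ n := by positivity
  calc CL (List.ofFn γ) * (En * En / (1 + t) ^ n) ≤ S * (En * En / (1 + t) ^ n) :=
        mul_le_mul_of_nonneg_right hC1 (by positivity)
    _ ≤ S * ((2 * ε) * En / (1 + t) ^ n) := by gcongr
    _ = (2 * S) * (ε * En / (1 + t) ^ n) := by ring
    _ ≤ (2 * S + 1) * (ε * En / (1 + t) ^ n) :=
        mul_le_mul_of_nonneg_right (by linarith) (by positivity)
    _ = (2 * S + 1) * ε / (1 + t) ^ n * En := by ring
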